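/- arXiv:math/0110307 — 2 statements merged into one kernel-verified Lean document; each statement's English description precedes it below -/
import Mathlib

section
/- (Transformation theorem) For integers L, M ≥ 0 and integers a, b with ab ≥ 0, Σ_{i=0}^M q^{i²/2} [L+M-i choose L] T(L-i, i, a, b) = q^{b²/2} T(L, M, a+b, b). -/
open Finset

noncomputable section

/-- The field of rational functions over ℚ in which the identities are stated. -/
abbrev K : Type := RatFunc ℚ

/-- The variable. -/
def tq : K := RatFunc.X

/-- Gaussian binomial coefficient `[n choose k]` in the variable `p`:
`∏_{j=1}^{k} (1 - p^(n-k+j))/(1 - p^j)` when `0 ≤ k ≤ n`, and `0` otherwise. -/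
def gb (p : K) (n k : ℤ) : K :=
  if 0 ≤ k ∧ k ≤ n then
    ∏ j ∈ Finset.range k.toNat, (1 - p ^ (n - k + 1 + (j : ℤ))) / (1 - p ^ (1 + (j : ℤ)))
  else 0

/-- The refined q-trinomial `T(L,M,a,b)`, in the variable `t = q^{1/2}` (so base-`q`
Gaussian binomials use `t^2`):
`T(L,M,a,b) = Σ_{n=0, n+a+L even}^{L} q^{n²/2} [M choose n][M+b+(L-a-n)/2 choose M+b]
[M-b+(L+a-n)/2 choose M-b]`. -/
def Trf (t : K) (L M a b : ℤ) : K :=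
  ∑ n ∈ Finset.range (L.toNat + 1),
    if Even ((n : ℤ) + a + L) then
      t ^ ((n : ℤ) ^ 2) * gb (t ^ 2) M n * gb (t ^ 2) (M + b + (L - a - n) / 2) (M + b) *
        gb (t ^ 2) (M - b + (L + a - n) / 2) (M - b)
    else 0

section qBinomial

variable {F : Type*} [Field F]

/-- The Gaussian binomial coefficient `[z choose k]` with an arbitrary integer as upper entry:
`∏_{j<k} (1 - q^(z-j))/(1 - q^(j+1))` for `0 ≤ k`, and `0` for `k < 0`. -/
def qBinom (q : F) (z k : ℤ) : F :=
  if 0 ≤ k then ∏ j ∈ range k.toNat, (1 - q ^ (z - (j : ℤ))) / (1 - q ^ (j + 1)) else 0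

/-- The `q`-factorial `(q; q)_n`. -/
def qFac (q : F) (n : ℕ) : F := ∏ j ∈ range n, (1 - q ^ (j + 1))

lemma qFac_succ (q : F) (n : ℕ) : qFac q (n + 1) = qFac q n * (1 - q ^ (n + 1)) :=
  prod_range_succ _ n

lemma qBinom_of_neg (q : F) (z : ℤ) {k : ℤ} (hk : k < 0) : qBinom q z k = 0 := by
  simp [qBinom, hk]

lemma qBinom_natCast (q : F) (z : ℤ) (k : ℕ) :
    qBinom q z k = ∏ j ∈ range k, (1 - q ^ (z - (j : ℤ))) / (1 - q ^ (j + 1)) := by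
  simp [qBinom]

@[simp] lemma qBinom_zero_right (q : F) (z : ℤ) : qBinom q z 0 = 1 := by
  simp [qBinom]

lemma qBinom_of_lt (q : F) {z k : ℤ} (hz : 0 ≤ z) (hzk : z < k) : qBinom q z k = 0 := by
  lift k to ℕ using by lia
  lift z to ℕ using hz
  rw [qBinom_natCast]
  exact prod_eq_zero (mem_range.2 (show z < k by lia)) (by simp)

lemma qBinom_succ_right (q : F) (z : ℤ) (k : ℕ) :
    qBinom q z (k + 1 : ℤ) = qBinom q z k * ((1 - q ^ (z - k)) / (1 - q ^ (k + 1))) := by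
  have h := qBinom_natCast q z (k + 1)
  rw [prod_range_succ, ← qBinom_natCast] at h
  exact_mod_cast h

lemma qBinom_succ_succ (q : F) (z : ℤ) (k : ℕ) :
    qBinom q (z + 1) (k + 1 : ℤ) = qBinom q z k * ((1 - q ^ (z + 1)) / (1 - q ^ (k + 1))) := by
  have h := qBinom_natCast q (z + 1) (k + 1)
  rw [prod_div_distrib, prod_range_succ', prod_range_succ (fun j => 1 - q ^ (j + 1))] at h
  rw [qBinom_natCast, prod_div_distrib]
  push_cast at h
  rw [h, mul_div_mul_comm]
  simp

lemma nonneg_of_qBinom_ne_zero {q : F} {z k : ℤ} (h : qBinom q z k ≠ 0) : 0 ≤ k := by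
  contrapose! h
  exact qBinom_of_neg q z h

lemma le_of_qBinom_ne_zero {q : F} {z k : ℤ} (h : qBinom q z k ≠ 0) (hz : 0 ≤ z) : k ≤ z := by
  contrapose! h
  exact qBinom_of_lt q hz h

lemma sum_range_shift {R : ℕ} (g : ℤ → F) (h0 : g (-1) = 0) (hR : g (R - 1) = 0) :
    ∑ j ∈ range R, g ((j : ℤ) - 1) = ∑ j ∈ range R, g j := by
  cases R with
  | zero => simp
  | succ R =>
    rw [sum_range_succ', sum_range_succ (fun j : ℕ => g j)]
    simp_all

/-- Reindexing of a sum over an initial segment along a permutation of `ℤ`. -/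
lemma sum_range_comp_equiv {f g : ℤ → F} (e : ℤ ≃ ℤ) {R S : ℕ}
    (hf : ∀ z, f z ≠ 0 → 0 ≤ z ∧ z < R) (hg : ∀ z, g z ≠ 0 → 0 ≤ z ∧ z < S)
    (h : ∀ z, f z = g (e z)) : ∑ j ∈ range R, f j = ∑ j ∈ range S, g j := by
  have key : ∀ (f : ℤ → F) (R : ℕ), (∀ z, f z ≠ 0 → 0 ≤ z ∧ z < R) →
      ∑ j ∈ range R, f j = ∑ᶠ z, f z := by
    intro f R hf
    rw [finsum_eq_sum_of_support_subset (s := (range R).map Nat.castEmbedding), sum_map]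
    · simp
    · intro z hz
      obtain ⟨h0, h1⟩ := hf z hz
      lift z to ℕ using h0
      simpa using h1
  rw [key f R hf, key g S hg, ← finsum_comp_equiv (f := g) e]
  exact finsum_congr h

variable {q : F} (hq : ∀ n : ℕ, q ^ (n + 1) ≠ 1)
include hq

lemma one_sub_pow_ne (n : ℕ) : 1 - q ^ (n + 1) ≠ 0 := sub_ne_zero.2 (hq n).symm

lemma qFac_ne_zero (n : ℕ) : qFac q n ≠ 0 := prod_ne_zero_iff.2 fun j _ => one_sub_pow_ne hq j

lemma qBinom_add_mul_qFac (n k : ℕ) :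
    qBinom q (n + k : ℤ) k * (qFac q k * qFac q n) = qFac q (n + k) := by
  induction k with
  | zero => simp [qFac]
  | succ k ih =>
    have h := qBinom_succ_succ q (n + k : ℤ) k
    have e : (n + (k + 1 : ℕ) : ℤ) = n + k + 1 := by push_cast; ring
    rw [e, Nat.cast_succ, h, ← add_assoc, qFac_succ, qFac_succ, ← ih]
    have := one_sub_pow_ne hq k
    have e2 : q ^ (n + k + 1 : ℤ) = q ^ (n + k + 1) := by exact_mod_cast zpow_natCast q (n + k + 1)
    rw [e2]
    field_simp

lemma qBinom_eq_div (n k : ℕ) :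
    qBinom q (n + k : ℤ) k = qFac q (n + k) / (qFac q k * qFac q n) := by
  rw [eq_div_iff (mul_ne_zero (qFac_ne_zero hq k) (qFac_ne_zero hq n)), qBinom_add_mul_qFac hq]

lemma qBinom_symm {n : ℤ} (hn : 0 ≤ n) (k : ℤ) : qBinom q n (n - k) = qBinom q n k := by
  rcases lt_or_ge k 0 with hk | hk
  · rw [qBinom_of_neg q n hk, qBinom_of_lt q hn (by lia)]
  rcases lt_or_ge n k with hk' | hk'
  · rw [qBinom_of_lt q hn hk', qBinom_of_neg q n (by lia)]
  lift k to ℕ using hk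
  obtain ⟨r, rfl⟩ : ∃ r : ℕ, n = r + k := ⟨(n - k).toNat, by lia⟩
  rw [qBinom_eq_div hq, add_sub_cancel_right, add_comm (r : ℤ), qBinom_eq_div hq, add_comm k,
    mul_comm (qFac q k)]

lemma qBinom_mul_qBinom {n : ℤ} (hn : 0 ≤ n) (k j : ℤ) :
    qBinom q n k * qBinom q k j = qBinom q n j * qBinom q (n - j) (k - j) := by
  rcases lt_or_ge j 0 with hj | hj
  · rcases lt_or_ge k 0 with hk | hk <;> simp [qBinom_of_neg, *]
  rcases lt_or_ge k j with hkj | hkj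
  · rw [qBinom_of_neg q (n - j) (by lia : k - j < 0)]
    rcases lt_or_ge k 0 with hk | hk
    · simp [qBinom_of_neg, hk]
    · simp [qBinom_of_lt q hk hkj]
  rcases lt_or_ge n k with hnk | hnk
  · rw [qBinom_of_lt q hn hnk]
    rcases lt_or_ge n j with hnj | hnj
    · simp [qBinom_of_lt q hn hnj]
    · rw [qBinom_of_lt q (z := n - j) (by lia) (by lia)]; simp
  lift j to ℕ using hj
  obtain ⟨r, rfl⟩ : ∃ r : ℕ, k = r + j := ⟨(k - j).toNat, by lia⟩
  obtain ⟨s, rfl⟩ : ∃ s : ℕ, n = s + r + j := ⟨(n - r - j).toNat, by lia⟩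
  have h1 := qBinom_eq_div hq s (r + j)
  have h2 := qBinom_eq_div hq (s + r) j
  push_cast at h1 h2
  rw [← add_assoc] at h1
  rw [h1, h2, qBinom_eq_div hq r j, add_sub_cancel_right, add_sub_cancel_right,
    qBinom_eq_div hq s r, ← add_assoc]
  have := qFac_ne_zero hq (r + j)
  have := qFac_ne_zero hq (s + r)
  field_simp

variable (hq0 : q ≠ 0)
include hq0

lemma qBinom_pascal (z k : ℤ) :
    qBinom q (z + 1) k = qBinom q z k + q ^ (z + 1 - k) * qBinom q z (k - 1) := by
  rcases lt_trichotomy k 0 with hk | rfl | hk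
  · simp [qBinom_of_neg q _ hk, qBinom_of_neg q z (by lia : k - 1 < 0)]
  · simp [qBinom_of_neg q z (by lia : (-1 : ℤ) < 0)]
  · obtain ⟨k, rfl⟩ : ∃ r : ℕ, k = r + 1 := ⟨(k - 1).toNat, by lia⟩
    rw [qBinom_succ_succ, qBinom_succ_right, add_sub_cancel_right,
      show z + 1 - (k + 1 : ℤ) = z - k by ring]
    have := one_sub_pow_ne hq k
    have e : q ^ (z + 1) = q ^ (z - k) * q ^ (k + 1) := by
      rw [← zpow_natCast, ← zpow_add₀ hq0]; congr 1; push_cast; ring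
    rw [e]
    field_simp
    ring

lemma qBinom_pascal' (z k : ℤ) :
    qBinom q (z + 1) k = q ^ k * qBinom q z k + qBinom q z (k - 1) := by
  rcases lt_trichotomy k 0 with hk | rfl | hk
  · simp [qBinom_of_neg q _ hk, qBinom_of_neg q z (by lia : k - 1 < 0)]
  · simp [qBinom_of_neg q z (by lia : (-1 : ℤ) < 0)]
  · obtain ⟨k, rfl⟩ : ∃ r : ℕ, k = r + 1 := ⟨(k - 1).toNat, by lia⟩
    rw [qBinom_succ_succ, qBinom_succ_right, add_sub_cancel_right]
    have := one_sub_pow_ne hq k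
    have e : q ^ (z + 1) = q ^ (z - k) * q ^ (k + 1) := by
      rw [← zpow_natCast, ← zpow_add₀ hq0]; congr 1; push_cast; ring
    have e2 : q ^ (k + 1 : ℤ) = q ^ (k + 1) := by exact_mod_cast zpow_natCast q (k + 1)
    rw [e, e2]
    field_simp
    ring

/-- The `q`-Vandermonde sum. -/
lemma qBinom_vandermonde (n R : ℕ) (hR : n < R) (z m : ℤ) :
    ∑ j ∈ range R, q ^ ((j : ℤ) * (z - m + j)) * qBinom q n j * qBinom q z (m - j) =
      qBinom q (n + z) m := by
  induction n generalizing z with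
  | zero =>
    rw [sum_eq_single 0]
    · simp
    · intro j _ hj
      rw [qBinom_of_lt q (by simp) (by simpa using Nat.pos_of_ne_zero hj)]; simp
    · simp; lia
  | succ n ih =>
    have h := ih (by lia) (z + 1)
    rw [show ((n + 1 : ℕ) : ℤ) + z = n + (z + 1) by push_cast; ring, ← h]
    have hs := sum_range_shift (R := R)
      (fun j => q ^ ((j + 1) * (z - m + (j + 1))) * qBinom q n j * qBinom q z (m - (j + 1)))
      (by simp [qBinom_of_neg]) (by simp [qBinom_of_lt q (z := n) (k := R - 1) (by lia) (by lia)])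
    simp only [sub_add_cancel] at hs
    simp_rw [Nat.cast_succ, qBinom_pascal' hq hq0 n, mul_add (q ^ (_ : ℤ)), add_mul (q ^ (_ : ℤ) * _),
      sum_add_distrib, hs, qBinom_pascal hq hq0 z, mul_add (_ * qBinom q _ _), sum_add_distrib]
    congr 1 <;> refine sum_congr rfl fun j _ => ?_
    · rw [← mul_assoc, ← zpow_add₀ hq0]; congr 3; ring
    · rw [show m - (j + 1 : ℤ) = m - j - 1 by ring, show (j + 1 : ℤ) * (z - m + (j + 1)) =
        j * (z + 1 - m + j) + (z + 1 - (m - j)) by ring, zpow_add₀ hq0]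
      ring

/-- The `q`-Vandermonde sum, with the complementary powers of `q`. -/
lemma qBinom_vandermonde' (n R : ℕ) (hR : n < R) (z m : ℤ) :
    ∑ j ∈ range R, q ^ (((n : ℤ) - j) * (m - j)) * qBinom q n j * qBinom q z (m - j) =
      qBinom q (n + z) m := by
  induction n generalizing z with
  | zero =>
    rw [sum_eq_single 0]
    · simp
    · intro j _ hj
      rw [qBinom_of_lt q (by simp) (by simpa using Nat.pos_of_ne_zero hj)]; simp
    · simp; lia
  | succ n ih =>
    have h := ih (by lia) (z + 1)
    rw [show ((n + 1 : ℕ) : ℤ) + z = n + (z + 1) by push_cast; ring, ← h]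
    have hs := sum_range_shift (R := R)
      (fun j => q ^ (((n : ℤ) + 1 - (j + 1)) * (m - (j + 1))) *
        (q ^ ((n : ℤ) + 1 - (j + 1)) * qBinom q n j) *
        qBinom q z (m - (j + 1)))
      (by simp [qBinom_of_neg]) (by simp [qBinom_of_lt q (z := n) (k := R - 1) (by lia) (by lia)])
    simp only [sub_add_cancel] at hs
    simp_rw [Nat.cast_succ, qBinom_pascal hq hq0 n, mul_add, add_mul, sum_add_distrib, hs, qBinom_pascal' hq hq0 z, mul_add, sum_add_distrib]
    congr 1 <;> refine sum_congr rfl fun j _ => ?_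
    · rw [show ((n : ℤ) + 1 - j) * (m - j) = (n - j) * (m - j) + (m - j) by ring,
        zpow_add₀ hq0]
      ring
    · rw [show m - (j + 1 : ℤ) = m - j - 1 by ring, ← mul_assoc, ← zpow_add₀ hq0]
      congr 3; ring

/-- The `q`-Pfaff–Saalschütz sum in terms of Gaussian binomial coefficients. -/
lemma qBinom_saalschutz (b R D P : ℕ) (hR : b < R) (m : ℤ) :
    ∑ s ∈ range R, q ^ (((b : ℤ) - s) * (m - s)) * qBinom q b s * qBinom q (D - b) (m - s) *
      qBinom q (P + s) D = qBinom q (P - D + b + m) m * qBinom q P (D - m) := by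
  have expand : ∀ s ∈ range R, q ^ (((b : ℤ) - s) * (m - s)) * qBinom q b s *
      qBinom q (D - b) (m - s) * qBinom q (P + s) D =
      ∑ j ∈ range R, (q ^ ((j : ℤ) * (P - D + j)) * qBinom q b j * qBinom q P (D - j)) *
        (q ^ (((b : ℤ) - s) * (m - s)) * qBinom q (b - j) (s - j) * qBinom q (D - b) (m - s)) := by
    intro s hs
    rw [add_comm (P : ℤ), ← qBinom_vandermonde hq hq0 s R (mem_range.1 hs), mul_sum]
    refine sum_congr rfl fun j _ => ?_
    linear_combination q ^ (((b : ℤ) - s) * (m - s)) * qBinom q (D - b) (m - s) *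
      q ^ ((j : ℤ) * (P - D + j)) * qBinom q P (D - j) *
      qBinom_mul_qBinom hq (Int.natCast_nonneg b) s j
  rw [sum_congr rfl expand, sum_comm]
  simp_rw [← mul_sum]
  have inner : ∀ j ∈ range R, (q ^ ((j : ℤ) * (P - D + j)) * qBinom q b j * qBinom q P (D - j)) *
      ∑ s ∈ range R, q ^ (((b : ℤ) - s) * (m - s)) * qBinom q (b - j) (s - j) *
        qBinom q (D - b) (m - s) =
      q ^ ((j : ℤ) * (P - D + m - m + j)) * qBinom q b j * qBinom q (P - D + m) (m - j) *
        qBinom q P (D - m) := by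
    intro j hj
    rcases lt_or_ge b j with hbj | hbj
    · simp [qBinom_of_lt q (z := b) (k := j) (by lia) (by lia)]
    obtain ⟨n, rfl⟩ := Nat.exists_eq_add_of_le hbj
    obtain ⟨r, rfl⟩ := Nat.exists_eq_add_of_le (by lia : j ≤ R)
    rw [sum_range_add, sum_eq_zero (s := range j), zero_add]
    · have h := qBinom_vandermonde' hq hq0 n r (by lia) (D - (j + n)) (m - j)
      have e : ∀ x : ℕ, q ^ (((j + n : ℕ) - (j + x : ℕ) : ℤ) * (m - (j + x : ℕ))) *
          qBinom q ((j + n : ℕ) - j) ((j + x : ℕ) - j) * qBinom q (D - (j + n : ℕ)) (m - (j + x : ℕ))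
          = q ^ (((n : ℤ) - x) * (m - j - x)) * qBinom q n x * qBinom q (D - (j + n)) (m - j - x) := by
        intro x
        push_cast
        rw [add_sub_add_left_eq_sub, add_sub_cancel_left, add_sub_cancel_left, sub_sub m]
      simp_rw [e]
      rw [h, show (n : ℤ) + (D - (j + n)) = D - j by ring, mul_assoc _ (qBinom q P (D - j))]
      have key : qBinom q P (D - j) * qBinom q (D - j) (m - j) =
          qBinom q P (D - m) * qBinom q (P - D + m) (m - j) := by
        rcases lt_or_ge ((D : ℤ) - j) 0 with hD | hD
        · rw [qBinom_of_neg q _ hD]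
          rcases lt_or_ge ((D : ℤ) - m) 0 with hm | hm
          · simp [qBinom_of_neg q _ hm]
          · simp [qBinom_of_neg q _ (by lia : m - j < 0)]
        · have h1 := qBinom_mul_qBinom hq (Int.natCast_nonneg P) (D - j) (D - m)
          have h2 := qBinom_symm hq hD (m - j)
          rw [show (D : ℤ) - j - (m - j) = D - m by ring] at h2
          rw [← h2, h1]
          congr 2 <;> ring
      rw [key, add_sub_cancel_right]
      ring
    · intro s hs
      rw [qBinom_of_neg q _ (by have := mem_range.1 hs; lia : (s : ℤ) - j < 0)]; simp
  rw [sum_congr rfl inner, ← sum_mul, qBinom_vandermonde hq hq0 b R hR]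
  congr 2; ring

/-- A Sears-type transformation obtained by two applications of the `q`-Saalschütz sum. -/
lemma qBinom_sears (A B M b c : ℕ) (hbA : b ≤ A) (hcA : c ≤ A) (hAB : A ≤ B) :
    ∑ i ∈ range (M + 1), q ^ ((i : ℤ) * (i - c)) * qBinom q (A + B - c + M - i) (A + B - c) *
        qBinom q i (i - c) * qBinom q (A + b) (i + b) * qBinom q (B - b) (i - b) =
      ∑ s ∈ range (b + 1), q ^ ((s : ℤ) * (s + c)) * qBinom q b s *
        qBinom q (B - b + s) (B - c) * qBinom q (M + b + A - c - s) (A - c - s) *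
        qBinom q (M - c + B) (B + s) := by
  obtain ⟨D, hD⟩ : ∃ D : ℕ, (D : ℤ) = B - c := ⟨B - c, by lia⟩
  obtain ⟨P, hP⟩ : ∃ P : ℕ, (P : ℤ) = B - b := ⟨B - b, by lia⟩
  have expand : ∀ i ∈ range (M + 1), q ^ ((i : ℤ) * (i - c)) *
      qBinom q (A + B - c + M - i) (A + B - c) * qBinom q i (i - c) * qBinom q (A + b) (i + b) *
      qBinom q (B - b) (i - b) =
      ∑ s ∈ range (b + 1), q ^ ((s : ℤ) * (s + c)) * qBinom q b s * qBinom q (B - b + s) (B - c) *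
        (q ^ (((b : ℤ) + i) * (i - c - s)) * qBinom q (A + b) (i + b) *
        qBinom q (B - c - b) (i - c - s) * qBinom q (A + B - c + M - i) (A + B - c)) := by
    intro i _
    have h := qBinom_saalschutz hq hq0 b (b + 1) D P (by simp) (i - c)
    have h' := qBinom_symm hq (Int.natCast_nonneg P) (i - b)
    rw [hP] at h'
    rw [hD, hP, show (B : ℤ) - b - (B - c) + b + (i - c) = i by ring,
      show (B : ℤ) - c - (i - c) = B - b - (i - b) by ring, h'] at h
    rw [mul_right_comm _ (qBinom q i (i - c)), mul_assoc _ (qBinom q i (i - c)), ← h, mul_sum]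
    refine sum_congr rfl fun s _ => ?_
    have e : q ^ ((i : ℤ) * (i - c)) * q ^ (((b : ℤ) - s) * (i - c - s)) =
        q ^ ((s : ℤ) * (s + c)) * q ^ (((b : ℤ) + i) * (i - c - s)) := by
      rw [← zpow_add₀ hq0, ← zpow_add₀ hq0]; congr 1; ring
    linear_combination qBinom q (A + B - c + M - i) (A + B - c) * qBinom q (A + b) (i + b) *
      qBinom q b s * qBinom q (B - c - b) (i - c - s) * qBinom q (B - b + s) (B - c) * e
  rw [sum_congr rfl expand, sum_comm]
  simp_rw [← mul_sum]
  refine sum_congr rfl fun s _ => ?_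
  rw [mul_assoc _ (qBinom q (M + b + A - c - s) (A - c - s))]
  congr 1
  have h := qBinom_saalschutz hq hq0 (A + b) (A + b + 1) (A + D) (D + M) (by simp) (A - c - s)
  push_cast at h
  rw [hD, show (B : ℤ) - c + M - (A + (B - c)) + (A + b) + (A - c - s) = M + b + A - c - s by ring,
    show (A : ℤ) + (B - c) - (A - c - s) = B + s by ring,
    show (B : ℤ) - c + M = M - c + B by ring] at h
  rw [← h]
  refine sum_range_comp_equiv (f := fun i => q ^ (((b : ℤ) + i) * (i - c - s)) *
    qBinom q (A + b) (i + b) * qBinom q (B - c - b) (i - c - s) *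
    qBinom q (A + B - c + M - i) (A + B - c))
    (g := fun j => q ^ (((A : ℤ) + b - j) * (A - c - s - j)) * qBinom q (A + b) j *
    qBinom q (A + (B - c) - (A + b)) (A - c - s - j) * qBinom q (M - c + B + j) (A + (B - c)))
    (Equiv.subLeft (A : ℤ)) ?_ ?_ ?_
  · intro z hz
    simp only [ne_eq, mul_eq_zero, not_or] at hz
    obtain ⟨⟨⟨-, h1⟩, h2⟩, h3⟩ := hz
    have h1 := le_of_qBinom_ne_zero h1 (by lia)
    have h2 := nonneg_of_qBinom_ne_zero h2
    have h3 := le_of_qBinom_ne_zero h3 (by lia)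
    lia
  · intro z hz
    simp only [ne_eq, mul_eq_zero, not_or] at hz
    obtain ⟨⟨⟨-, h1⟩, -⟩, -⟩ := hz
    have h2 := nonneg_of_qBinom_ne_zero h1
    have h1 := le_of_qBinom_ne_zero h1 (by lia)
    lia
  · intro z
    simp only [Equiv.subLeft_apply]
    have h1 := qBinom_symm hq (by lia : (0 : ℤ) ≤ A + b) (z + b)
    rw [← h1]
    congr 1
    · congr 1
      · congr 1
        · congr 1; ring
        · congr 1; ring
      · congr 1 <;> ring
    · congr 1 <;> ring

end qBinomial

section qTrinomial

lemma gb_ne_zero {p : K} {n k : ℤ} (h : gb p n k ≠ 0) : 0 ≤ k ∧ k ≤ n := by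
  contrapose! h
  rw [gb, if_neg (by lia)]

lemma gb_eq_qBinom (p : K) {n : ℤ} (hn : 0 ≤ n) (k : ℤ) : gb p n k = qBinom p n k := by
  unfold gb
  split_ifs with h
  · obtain ⟨h0, h1⟩ := h
    lift k to ℕ using h0
    rw [qBinom_natCast, prod_div_distrib, prod_div_distrib, Int.toNat_natCast,
      ← prod_range_reflect (fun j : ℕ => 1 - p ^ (n - (j : ℤ)))]
    congr 1
    · refine prod_congr rfl fun j hj => ?_
      have := mem_range.1 hj
      congr 2
      lia
    · refine prod_congr rfl fun j _ => ?_
      rw [add_comm]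
      exact_mod_cast rfl
  · rcases lt_or_ge k 0 with hk | hk
    · rw [qBinom_of_neg p n hk]
    · rw [qBinom_of_lt p hn (by lia)]

/-- The summand of `Trf`, with an integer summation variable. -/
def trfTerm (t : K) (L M a b n : ℤ) : K :=
  if Even (n + a + L) then
    t ^ (n ^ 2) * gb (t ^ 2) M n * gb (t ^ 2) (M + b + (L - a - n) / 2) (M + b) *
      gb (t ^ 2) (M - b + (L + a - n) / 2) (M - b)
  else 0

lemma trfTerm_ne_zero {t : K} {L M a b n : ℤ} (h : trfTerm t L M a b n ≠ 0) :
    0 ≤ n ∧ n ≤ M ∧ n ≤ L := by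
  unfold trfTerm at h
  split_ifs at h with he
  · simp only [ne_eq, mul_eq_zero, not_or] at h
    obtain ⟨⟨⟨-, h1⟩, h2⟩, h3⟩ := h
    have h1 := gb_ne_zero h1
    have h2 := gb_ne_zero h2
    have h3 := gb_ne_zero h3
    obtain ⟨r, hr⟩ := he
    lia
  · exact absurd rfl h

lemma Trf_eq_sum (t : K) (L a b : ℤ) (M : ℕ) :
    Trf t L M a b = ∑ n ∈ range (M + 1), trfTerm t L M a b n :=
  sum_range_comp_equiv (f := trfTerm t L M a b) (Equiv.refl ℤ)
    (fun _ hz => by have := trfTerm_ne_zero hz; lia)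
    (fun _ hz => by have := trfTerm_ne_zero hz; lia) fun _ => rfl

lemma Trf_eq_sum_sub (t : K) (L a b : ℤ) {i M : ℕ} (hi : i ≤ M) :
    Trf t L i a b = ∑ c ∈ range (M + 1), trfTerm t L i a b (i - c) := by
  rw [Trf_eq_sum]
  exact sum_range_comp_equiv (f := trfTerm t L i a b) (g := fun c => trfTerm t L i a b (i - c))
    (Equiv.subLeft (i : ℤ)) (fun _ hz => by have := trfTerm_ne_zero hz; lia)
    (fun _ hz => by have := trfTerm_ne_zero hz; lia) fun _ => by simp

lemma Trf_neg_neg (t : K) (L M a b : ℤ) : Trf t L M (-a) (-b) = Trf t L M a b := by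
  refine sum_congr rfl fun n _ => ?_
  have : Even ((n : ℤ) + -a + L) ↔ Even ((n : ℤ) + a + L) := by
    simp [Int.even_add, parity_simps]
  simp only [this, sub_neg_eq_add, ← sub_eq_add_neg M, ← sub_eq_add_neg L]
  split_ifs <;> ring

/-- The common refinement of the two sides of the transformation. -/
def transformTerm (t : K) (L M a b c s : ℤ) : K :=
  if Even (c + a + L) then
    t ^ (c ^ 2) * ((t ^ 2) ^ (s * (s + c)) * gb (t ^ 2) b s *
      gb (t ^ 2) ((L + c + a) / 2 - b + s) ((L + c + a) / 2 - c) *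
      gb (t ^ 2) (M + b + (L + c - a) / 2 - c - s) (M + b) *
      gb (t ^ 2) (M - c + (L + c + a) / 2) ((L + c + a) / 2 + s))
  else 0

lemma transformTerm_ne_zero {t : K} {L M a b c s : ℤ} (h : transformTerm t L M a b c s ≠ 0) :
    b - s ≤ c ∧ c ≤ M - s ∧ 0 ≤ s ∧ s ≤ b := by
  unfold transformTerm at h
  split_ifs at h with he
  · simp only [ne_eq, mul_eq_zero, not_or] at h
    obtain ⟨-, ⟨⟨⟨-, h1⟩, h2⟩, -⟩, h4⟩ := h
    have h1 := gb_ne_zero h1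
    have h2 := gb_ne_zero h2
    have h4 := gb_ne_zero h4
    lia
  · exact absurd rfl h

variable {t : K} (ht0 : t ≠ 0) (ht : ∀ n : ℕ, (t ^ 2) ^ (n + 1) ≠ 1)
include ht0 ht

lemma sum_trfTerm_eq_sum_transformTerm (L M a b c : ℕ) :
    ∑ i ∈ range (M + 1), t ^ ((i : ℤ) ^ 2) * gb (t ^ 2) ((L : ℤ) + M - i) L *
        trfTerm t ((L : ℤ) - i) i a b (i - c) =
      ∑ s ∈ range (b + 1), transformTerm t L M a b c s := by
  by_cases he : Even ((c : ℤ) + a + L)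
  swap
  · have he' : ∀ i : ℤ, ¬ Even (i - c + a + (L - i)) := by
      rintro i ⟨r, hr⟩
      exact he ⟨r + c, by lia⟩
    simp [trfTerm, transformTerm, he, he']
  have he' : ∀ i : ℤ, Even (i - c + a + (L - i)) := by
    intro i
    obtain ⟨r, hr⟩ := he
    exact ⟨r - c, by lia⟩
  obtain ⟨B, hB⟩ := he
  have hB2 : ((L : ℤ) + c + a) / 2 = B := by lia
  have hA2 : ((L : ℤ) + c - a) / 2 = B - a := by lia
  have hA : ∀ i : ℤ, (i + b + ((L : ℤ) - i - a - (i - c)) / 2) = B - a + b := by lia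
  have hBi : ∀ i : ℤ, (i - b + ((L : ℤ) - i + a - (i - c)) / 2) = B - b := by lia
  have he2 : Even ((c : ℤ) + a + L) := ⟨B, hB⟩
  simp only [trfTerm, transformTerm, he', he2, if_true, hA2, hB2, hA, hBi]
  by_cases hcase : (b : ℤ) ≤ B - a ∧ (c : ℤ) ≤ B - a
  · obtain ⟨A, rfl⟩ : ∃ A : ℕ, B = (A + a : ℕ) := ⟨(B - a).toNat, by lia⟩
    have hbA : b ≤ A := by lia
    have hcA : c ≤ A := by lia
    have h := qBinom_sears ht (pow_ne_zero 2 ht0) A (A + a) M b c hbA hcA (by lia)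
    push_cast at h ⊢
    simp only [add_sub_cancel_right] at h ⊢
    rw [← mul_sum]
    have hR : ∀ s ∈ range (b + 1), (t ^ 2) ^ ((s : ℤ) * (s + c)) * gb (t ^ 2) b s *
        gb (t ^ 2) (A + a - b + s) (A + a - c) * gb (t ^ 2) (M + b + A - c - s) (M + b) *
        gb (t ^ 2) (M - c + (A + a)) (A + a + s) = (t ^ 2) ^ ((s : ℤ) * (s + c)) *
        qBinom (t ^ 2) b s * qBinom (t ^ 2) (A + a - b + s) (A + a - c) *
        qBinom (t ^ 2) (M + b + A - c - s) (A - c - s) *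
        qBinom (t ^ 2) (M - c + (A + a)) (A + a + s) := by
      intro s _
      rw [gb_eq_qBinom _ (Int.natCast_nonneg b),
        gb_eq_qBinom _ (by lia : (0 : ℤ) ≤ A + a - b + s),
        gb_eq_qBinom _ (by lia : (0 : ℤ) ≤ M - c + (A + a))]
      congr 2
      rcases lt_or_ge ((A : ℤ) - c - s) 0 with hneg | hpos
      · rw [qBinom_of_neg _ _ hneg]
        by_contra hne
        have := gb_ne_zero hne
        lia
      · rw [gb_eq_qBinom _ (by lia), ← qBinom_symm ht (by lia)]
        congr 1
        ring
    rw [sum_congr rfl hR, ← h, mul_sum]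
    refine sum_congr rfl fun i hi => ?_
    have hi := mem_range.1 hi
    have hL : (L : ℤ) = A + (A + a) - c := by push_cast at hB; lia
    have e : t ^ ((i : ℤ) ^ 2) * t ^ (((i : ℤ) - c) ^ 2) =
        t ^ ((c : ℤ) ^ 2) * (t ^ 2) ^ ((i : ℤ) * (i - c)) := by
      simp_rw [← zpow_natCast t 2, ← zpow_mul, ← zpow_add₀ ht0]
      congr 1; push_cast; ring
    rw [hL, gb_eq_qBinom _ (by lia : (0 : ℤ) ≤ A + (A + a) - c + M - i),
      gb_eq_qBinom _ (Int.natCast_nonneg i), gb_eq_qBinom _ (by lia : (0 : ℤ) ≤ A + b),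
      gb_eq_qBinom _ (by lia : (0 : ℤ) ≤ A + a - b)]
    linear_combination qBinom (t ^ 2) (A + (A + a) - c + M - i) (A + (A + a) - c) *
      qBinom (t ^ 2) i (i - c) * qBinom (t ^ 2) (A + b) (i + b) *
      qBinom (t ^ 2) (A + a - b) (i - b) * e
  · rw [sum_eq_zero, sum_eq_zero]
    · intro s _
      by_contra! hne
      simp only [ne_eq, mul_eq_zero, not_or] at hne
      obtain ⟨-, ⟨⟨⟨-, h1⟩, h2⟩, h3⟩, -⟩ := hne
      have h1 := gb_ne_zero h1
      have h2 := gb_ne_zero h2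
      have h3 := gb_ne_zero h3
      lia
    · intro i _
      by_contra! hne
      simp only [ne_eq, mul_eq_zero, not_or] at hne
      obtain ⟨-, ⟨⟨-, h1⟩, h2⟩, h3⟩ := hne
      have h1 := gb_ne_zero h1
      have h2 := gb_ne_zero h2
      have h3 := gb_ne_zero h3
      lia

lemma sum_transformTerm_eq_trfTerm (L M a b m : ℕ) :
    ∑ s ∈ range (b + 1), transformTerm t L M a b (m + b - 2 * s) s =
      t ^ ((b : ℤ) ^ 2) * trfTerm t L M (a + b) b m := by
  by_cases he : Even ((m : ℤ) + (a + b) + L)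
  swap
  · have he' : ∀ s : ℤ, ¬ Even (m + b - 2 * s + a + L) := by
      rintro s ⟨r, hr⟩
      exact he ⟨r + s, by lia⟩
    simp [trfTerm, transformTerm, he, he']
  have he' : ∀ s : ℤ, Even (m + b - 2 * s + a + L) := by
    intro s
    obtain ⟨r, hr⟩ := he
    exact ⟨r - s, by lia⟩
  have he2 := he
  obtain ⟨r, hr⟩ := he
  obtain ⟨k, hk⟩ : ∃ k : ℤ, k = r - a - b - m := ⟨_, rfl⟩
  have hB : ∀ s : ℤ, ((L : ℤ) + (m + b - 2 * s) + a) / 2 = k + a + b + m - s := by lia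
  have hA : ∀ s : ℤ, (M : ℤ) + b + ((L : ℤ) + (m + b - 2 * s) - a) / 2 - (m + b - 2 * s) - s =
    M + b + k := by lia
  have hl1 : ((L : ℤ) - (a + b) - m) / 2 = k := by lia
  have hl2 : ((L : ℤ) + (a + b) - m) / 2 = k + a + b := by lia
  simp only [trfTerm, transformTerm, he', he2, if_true, hA, hB, hl1, hl2]
  rcases lt_or_ge k 0 with hk0 | hk0
  · have h0 : gb (t ^ 2) ((M : ℤ) + b + k) (M + b) = 0 := by
      by_contra hne
      have := gb_ne_zero hne
      lia
    simp [h0]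
  lift k to ℕ using hk0
  have h := qBinom_saalschutz ht (pow_ne_zero 2 ht0) b (b + 1) (k + a + b + m) (M + k + a)
    (by simp) m
  push_cast at h
  rw [show (M : ℤ) + k + a - (k + a + b + m) + b + m = M by ring,
    show (k : ℤ) + a + b + m - m = k + a + b by ring] at h
  have hsymm := qBinom_symm ht (by lia : (0 : ℤ) ≤ M + k + a) (M - b)
  rw [show (M : ℤ) + k + a - (M - b) = k + a + b by ring] at hsymm
  have hrhs : t ^ ((b : ℤ) ^ 2) * (t ^ ((m : ℤ) ^ 2) * gb (t ^ 2) M m *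
      gb (t ^ 2) (M + b + k) (M + b) * gb (t ^ 2) (M - b + (k + a + b)) (M - b)) =
      t ^ ((b : ℤ) ^ 2) * t ^ ((m : ℤ) ^ 2) * gb (t ^ 2) (M + b + k) (M + b) *
      (qBinom (t ^ 2) M m * qBinom (t ^ 2) (M + k + a) (k + a + b)) := by
    rw [gb_eq_qBinom _ (Int.natCast_nonneg M), show (M : ℤ) - b + (k + a + b) = M + k + a by ring,
      gb_eq_qBinom _ (by lia : (0 : ℤ) ≤ M + k + a), hsymm]
    ring
  rw [hrhs, ← h, mul_sum]
  refine sum_congr rfl fun s hs => ?_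
  have hs := mem_range.1 hs
  rw [gb_eq_qBinom _ (Int.natCast_nonneg b),
    show (k : ℤ) + a + b + m - s - b + s = k + a + m by ring,
    show (k : ℤ) + a + b + m - s - (m + b - 2 * s) = k + a + m - (m - s) by ring,
    gb_eq_qBinom _ (by lia : (0 : ℤ) ≤ k + a + m), qBinom_symm ht (by lia),
    show (M : ℤ) - (m + b - 2 * s) + (k + a + b + m - s) = M + k + a + s by ring,
    gb_eq_qBinom _ (by lia : (0 : ℤ) ≤ M + k + a + s), sub_add_cancel,
    show (k : ℤ) + a + b + m - b = k + a + m by ring]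
  have e : t ^ (((m : ℤ) + b - 2 * s) ^ 2) * (t ^ 2) ^ ((s : ℤ) * (s + (m + b - 2 * s))) =
      t ^ ((b : ℤ) ^ 2) * t ^ ((m : ℤ) ^ 2) * (t ^ 2) ^ (((b : ℤ) - s) * (m - s)) := by
    simp_rw [← zpow_natCast t 2, ← zpow_mul, ← zpow_add₀ ht0]
    congr 1; push_cast; ring
  linear_combination qBinom (t ^ 2) b s * qBinom (t ^ 2) (k + a + m) (m - s) *
    gb (t ^ 2) (M + b + k) (M + b) * qBinom (t ^ 2) (M + k + a + s) (k + a + b + m) * e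

lemma Trf_transform_of_nonneg (L M a b : ℕ) :
    ∑ i ∈ range (M + 1),
      t ^ ((i : ℤ) ^ 2) * gb (t ^ 2) ((L : ℤ) + M - i) L * Trf t ((L : ℤ) - i) i a b =
      t ^ ((b : ℤ) ^ 2) * Trf t L M (a + b) b := by
  have hL : ∀ i ∈ range (M + 1),
      t ^ ((i : ℤ) ^ 2) * gb (t ^ 2) ((L : ℤ) + M - i) L * Trf t ((L : ℤ) - i) i a b =
      ∑ c ∈ range (M + 1), t ^ ((i : ℤ) ^ 2) * gb (t ^ 2) ((L : ℤ) + M - i) L *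
        trfTerm t ((L : ℤ) - i) i a b (i - c) := by
    intro i hi
    rw [Trf_eq_sum_sub t _ a b (Nat.lt_succ_iff.1 (mem_range.1 hi)), mul_sum]
  rw [sum_congr rfl hL, sum_comm, Trf_eq_sum, mul_sum]
  simp_rw [sum_trfTerm_eq_sum_transformTerm ht0 ht, ← sum_transformTerm_eq_trfTerm ht0 ht]
  rw [sum_comm, sum_comm (t := range (b + 1))]
  refine sum_congr rfl fun s _ => ?_
  exact sum_range_comp_equiv (f := fun c => transformTerm t L M a b c s)
    (g := fun m => transformTerm t L M a b (m + b - 2 * s) s)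
    (Equiv.addRight (2 * s - b : ℤ)) (fun _ hz => by have := transformTerm_ne_zero hz; lia)
    (fun _ hz => by have := transformTerm_ne_zero hz; lia) fun c => by
      simp only [Equiv.coe_addRight]; congr 1; ring

end qTrinomial

lemma tq_ne_zero : tq ≠ 0 := RatFunc.X_ne_zero

lemma tq_sq_pow_ne_one (n : ℕ) : (tq ^ 2) ^ (n + 1) ≠ 1 := by
  rw [← pow_mul, tq, ← RatFunc.algebraMap_X, ← map_pow,
    ← map_one (algebraMap (Polynomial ℚ) (RatFunc ℚ))]
  intro h
  have h := congrArg Polynomial.natDegree (RatFunc.algebraMap_injective ℚ h)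
  simp at h

/-- Transformation theorem: for `ab ≥ 0`,
`Σ_{i=0}^M q^{i²/2} [L+M-i choose L] T(L-i, i, a, b) = q^{b²/2} T(L, M, a+b, b)`
(in the variable `t = q^{1/2}`, so `q = t^2`). -/
theorem T_transform (L M : ℕ) (a b : ℤ) (hab : 0 ≤ a * b) :
    ∑ i ∈ Finset.range (M + 1),
      tq ^ ((i : ℤ) ^ 2) * gb (tq ^ 2) ((L : ℤ) + M - i) L * Trf tq ((L : ℤ) - i) i a b =
      tq ^ (b ^ 2) * Trf tq L M (a + b) b := by
  have key := Trf_transform_of_nonneg tq_ne_zero tq_sq_pow_ne_one L M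
  rcases mul_nonneg_iff.1 hab with ⟨ha, hb⟩ | ⟨ha, hb⟩
  · lift a to ℕ using ha
    lift b to ℕ using hb
    exact key a b
  · obtain ⟨a, rfl⟩ := Int.exists_eq_neg_ofNat ha
    obtain ⟨b, rfl⟩ := Int.exists_eq_neg_ofNat hb
    simp_rw [← neg_add, Trf_neg_neg, neg_sq]
    exact key a b
end
end

section
/- (Theorem: S-to-B double-sum transformation) For integers L, M, a, b with M ≤ L and |a-b| ≤ M whenever |a| ≤ M/2, |a+b| ≤ L and |a-b| ≤ max{L,M}: Σ_{i=0}^{L-M} Σ_{k=0}^{L} q^{Mi + k²} [L-M choose i][L+M-2i-2k choose L-i] B(k, L-i-k, a, b) = q^{a²} S(L, M, a+b, 2a). -/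
open Finset

noncomputable section

/-- The refined q-trinomial
`S(L,M,a,b) = Σ_{k=0}^L p^{k(k+a)} [L+M-a-2k choose M][M-a+b choose k][M+a-b choose k+a]`. -/
def Sr (p : K) (L M a b : ℤ) : K :=
  ∑ k ∈ Finset.range (L.toNat + 1),
    p ^ ((k : ℤ) * ((k : ℤ) + a)) * gb p (L + M - a - 2 * k) M * gb p (M - a + b) k *
      gb p (M + a - b) ((k : ℤ) + a)

/-- `B(L,M,a,b) = [M+b+L-a choose M+b][M-b+L+a choose M-b]`, allowing half-integer `L, a`
(the combinations `L-a` and `L+a` are integers in all uses, so the floors are exact). -/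
def Bq (p : K) (L M a b : ℚ) : K :=
  gb p ⌊M + b + L - a⌋ ⌊M + b⌋ * gb p ⌊M - b + L + a⌋ ⌊M - b⌋

/-- `p` is nonzero and not a root of unity. -/
def IsGeneric (p : K) : Prop := p ≠ 0 ∧ ∀ n : ℕ, 1 - p ^ ((n : ℤ) + 1) ≠ 0

lemma tq_isGeneric : IsGeneric tq := by
  refine ⟨RatFunc.X_ne_zero, fun n h => ?_⟩
  have h1 : tq ^ (n + 1) = 1 := by
    rw [sub_eq_zero] at h
    exact_mod_cast h.symm
  have h2 : (algebraMap (Polynomial ℚ) K) (Polynomial.X ^ (n + 1)) =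
      algebraMap (Polynomial ℚ) K 1 := by
    simpa [tq] using h1
  have h3 := congrArg Polynomial.natDegree (RatFunc.algebraMap_injective ℚ h2)
  simp at h3

/-- The Gaussian binomial coefficient `[x choose k]` with an arbitrary integer upper entry, as the
Laurent polynomial `∏_{j<k} (1 - p^(x-j))/(1 - p^(j+1))` in `p^x`; it is zero for `k < 0`. -/
def pbin (p : K) (x k : ℤ) : K :=
  if 0 ≤ k then
    ∏ j ∈ Finset.range k.toNat, (1 - p ^ (x - (j : ℤ))) / (1 - p ^ ((j : ℤ) + 1))
  else 0

/-- The `q`-factorial `∏_{j=1}^{n} (1 - p^j)`. -/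
def qfac (p : K) (n : ℤ) : K := ∏ j ∈ Finset.range n.toNat, (1 - p ^ ((j : ℤ) + 1))

/-- The reciprocal of the `q`-factorial, zero at negative integers. -/
def qfacInv (p : K) (n : ℤ) : K := if 0 ≤ n then (qfac p n)⁻¹ else 0

section

variable {p : K}

lemma pbin_of_neg (x : ℤ) {k : ℤ} (hk : k < 0) : pbin p x k = 0 := if_neg (by omega)

@[simp] lemma pbin_zero_right (x : ℤ) : pbin p x 0 = 1 := by simp [pbin]

lemma pbin_of_lt {x k : ℤ} (hx : 0 ≤ x) (hk : x < k) : pbin p x k = 0 := by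
  rw [pbin, if_pos (by omega)]
  refine Finset.prod_eq_zero (i := x.toNat) (by simp; omega) ?_
  simp [Int.toNat_of_nonneg hx]

lemma pbin_succ (x : ℤ) (k : ℕ) :
    pbin p x ((k : ℤ) + 1) = pbin p x k * ((1 - p ^ (x - k)) / (1 - p ^ ((k : ℤ) + 1))) := by
  rw [pbin, pbin, if_pos (by omega), if_pos (by omega), show ((k : ℤ) + 1).toNat = k + 1 by omega,
    Finset.prod_range_succ]
  simp

lemma pbin_succ_succ (x : ℤ) (k : ℕ) :
    pbin p (x + 1) ((k : ℤ) + 1) =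
      pbin p x k * ((1 - p ^ (x + 1)) / (1 - p ^ ((k : ℤ) + 1))) := by
  induction k with
  | zero => simpa using pbin_succ (p := p) (x + 1) 0
  | succ k ih =>
    rw [pbin_succ]
    push_cast
    rw [ih, pbin_succ, show x + 1 - ((k : ℤ) + 1) = x - k by ring]
    ring

lemma pbin_add_one (hp : IsGeneric p) (x k : ℤ) :
    pbin p (x + 1) k = pbin p x k + p ^ (x + 1 - k) * pbin p x (k - 1) := by
  rcases lt_trichotomy k 0 with hk | rfl | hk
  · simp [pbin_of_neg _ hk, pbin_of_neg _ (show k - 1 < 0 by omega)]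
  · simp [pbin_of_neg _ (show (-1 : ℤ) < 0 by omega)]
  · obtain ⟨m, rfl⟩ : ∃ m : ℕ, k = (m : ℤ) + 1 := ⟨(k - 1).toNat, by omega⟩
    have h := hp.2 m
    rw [pbin_succ_succ, pbin_succ, add_sub_cancel_right,
      show x + 1 = (x - m) + ((m : ℤ) + 1) by ring, zpow_add₀ hp.1,
      show x - m + ((m : ℤ) + 1) - (m + 1) = x - m by ring]
    field_simp
    ring

lemma pbin_add_one' (hp : IsGeneric p) (x k : ℤ) :
    pbin p (x + 1) k = p ^ k * pbin p x k + pbin p x (k - 1) := by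
  rcases lt_trichotomy k 0 with hk | rfl | hk
  · simp [pbin_of_neg _ hk, pbin_of_neg _ (show k - 1 < 0 by omega)]
  · simp [pbin_of_neg _ (show (-1 : ℤ) < 0 by omega)]
  · obtain ⟨m, rfl⟩ : ∃ m : ℕ, k = (m : ℤ) + 1 := ⟨(k - 1).toNat, by omega⟩
    have h := hp.2 m
    rw [pbin_succ_succ, pbin_succ, add_sub_cancel_right,
      show x + 1 = (x - m) + ((m : ℤ) + 1) by ring, zpow_add₀ hp.1]
    field_simp
    ring

lemma pbin_zero_left {k : ℤ} (hk : k ≠ 0) : pbin p 0 k = 0 := by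
  rcases lt_or_gt_of_ne hk with h | h
  · exact pbin_of_neg _ h
  · exact pbin_of_lt le_rfl h

lemma qfac_ne_zero (hp : IsGeneric p) (n : ℤ) : qfac p n ≠ 0 :=
  Finset.prod_ne_zero_iff.2 fun j _ => hp.2 j

lemma qfac_mul_qfacInv (hp : IsGeneric p) {n : ℤ} (hn : 0 ≤ n) : qfac p n * qfacInv p n = 1 := by
  rw [qfacInv, if_pos hn, mul_inv_cancel₀ (qfac_ne_zero hp n)]

lemma qfacInv_of_neg {n : ℤ} (hn : n < 0) : qfacInv p n = 0 := if_neg (by omega)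

lemma qfac_natCast_succ (n : ℕ) :
    qfac p ((n : ℤ) + 1) = qfac p n * (1 - p ^ ((n : ℤ) + 1)) := by
  rw [qfac, qfac, show ((n : ℤ) + 1).toNat = n + 1 by omega, Finset.prod_range_succ]
  simp

lemma pbin_eq_qfac (hp : IsGeneric p) {n : ℤ} (k : ℤ) (hn : 0 ≤ n) :
    pbin p n k = qfac p n * qfacInv p k * qfacInv p (n - k) := by
  rcases lt_or_ge k 0 with hk | hk
  · simp [pbin_of_neg _ hk, qfacInv_of_neg hk]
  rcases lt_or_ge n k with hnk | hnk
  · simp [pbin_of_lt hn hnk, qfacInv_of_neg (show n - k < 0 by omega)]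
  lift k to ℕ using hk
  induction k with
  | zero =>
    have h0 : qfacInv p 0 = 1 := by simp [qfacInv, qfac]
    simp [h0, qfac_mul_qfacInv hp hn]
  | succ k ih =>
    push_cast at hnk ⊢
    obtain ⟨m, hm⟩ : ∃ m : ℕ, n - ((k : ℤ) + 1) = m := ⟨(n - (k + 1)).toNat, by omega⟩
    rw [pbin_succ, ih (by omega), hm, show n - (k : ℤ) = (m : ℤ) + 1 by omega]
    simp only [qfacInv, if_pos (show (0 : ℤ) ≤ k by omega), if_pos (show (0 : ℤ) ≤ m by omega),
      if_pos (show (0 : ℤ) ≤ (m : ℤ) + 1 by omega), if_pos (show (0 : ℤ) ≤ (k : ℤ) + 1 by omega),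
      qfac_natCast_succ]
    have := qfac_ne_zero hp k
    have := qfac_ne_zero hp m
    have := hp.2 k
    have := hp.2 m
    field_simp

lemma gb_eq_pbin {n : ℤ} (k : ℤ) (hn : 0 ≤ n) : gb p n k = pbin p n k := by
  rcases lt_or_ge k 0 with hk | hk
  · rw [pbin_of_neg _ hk, gb, if_neg (by omega)]
  rcases lt_or_ge n k with hnk | hnk
  · rw [pbin_of_lt hn hnk, gb, if_neg (by omega)]
  rw [gb, pbin, if_pos ⟨hk, hnk⟩, if_pos hk, Finset.prod_div_distrib, Finset.prod_div_distrib]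
  congr 1
  · rw [← Finset.prod_range_reflect]
    refine Finset.prod_congr rfl fun j hj => ?_
    rw [Finset.mem_range] at hj
    rw [show n - k + 1 + ((k.toNat - 1 - j : ℕ) : ℤ) = n - j by omega]
  · exact Finset.prod_congr rfl fun j _ => by rw [add_comm]

lemma gb_eq_qfac (hp : IsGeneric p) {n : ℤ} (k : ℤ) (hn : 0 ≤ n) :
    gb p n k = qfac p n * qfacInv p k * qfacInv p (n - k) := by
  rw [gb_eq_pbin k hn, pbin_eq_qfac hp k hn]

lemma gb_of_neg (n : ℤ) {k : ℤ} (hk : k < 0) : gb p n k = 0 := if_neg (by omega)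

lemma gb_of_lt {n k : ℤ} (hk : n < k) : gb p n k = 0 := if_neg (by omega)

lemma gb_support {n k : ℤ} (h : gb p n k ≠ 0) : 0 ≤ k ∧ k ≤ n := by
  by_contra h'
  exact h (if_neg h')

lemma gb_symm (hp : IsGeneric p) (n k : ℤ) : gb p n k = gb p n (n - k) := by
  rcases lt_or_ge n 0 with hn | hn
  · rw [gb, gb, if_neg (by omega), if_neg (by omega)]
  · rw [gb_eq_qfac hp _ hn, gb_eq_qfac hp _ hn, sub_sub_cancel]
    ring

lemma pbin_mul_pbin_natCast (hp : IsGeneric p) (x : ℤ) (s m : ℕ) :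
    pbin p x ((s : ℤ) + m) * pbin p ((s : ℤ) + m) s = pbin p x s * pbin p (x - s) m := by
  have num (y : ℤ) (k : ℕ) :
      pbin p y k = (∏ j ∈ Finset.range k, (1 - p ^ (y - (j : ℤ)))) * qfacInv p k := by
    rw [pbin, if_pos (by omega), Finset.prod_div_distrib, qfacInv, if_pos (by omega), qfac]
    simp [div_eq_mul_inv]
  rw [pbin_eq_qfac hp _ (show (0 : ℤ) ≤ (s : ℤ) + m by omega), add_sub_cancel_left]
  have h := num x (s + m)
  push_cast at h
  rw [h, num, num, Finset.prod_range_add]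
  have h1 := qfac_mul_qfacInv hp (show (0 : ℤ) ≤ (s : ℤ) + m by omega)
  simp only [Nat.cast_add, ← sub_sub]
  linear_combination (∏ j ∈ Finset.range s, (1 - p ^ (x - (j : ℤ)))) *
    (∏ j ∈ Finset.range m, (1 - p ^ (x - s - (j : ℤ)))) * qfacInv p s * qfacInv p m * h1

lemma pbin_mul_pbin (hp : IsGeneric p) (x k s : ℤ) :
    pbin p x k * pbin p k s = pbin p x s * pbin p (x - s) (k - s) := by
  rcases lt_or_ge s 0 with hs | hs
  · simp [pbin_of_neg _ hs]
  rcases lt_or_ge k s with hk | hk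
  · rw [pbin_of_neg (x - s) (show k - s < 0 by omega), mul_zero]
    rcases lt_or_ge k 0 with hk0 | hk0
    · rw [pbin_of_neg _ hk0, zero_mul]
    · rw [pbin_of_lt hk0 hk, mul_zero]
  obtain ⟨m, hm⟩ : ∃ m : ℕ, k - s = m := ⟨(k - s).toNat, by omega⟩
  lift s to ℕ using hs
  obtain rfl : k = (s : ℤ) + m := by omega
  rw [pbin_mul_pbin_natCast hp, hm]

lemma eq_apply_zero_of_apply_add_one {α : Type*} {f : ℤ → α} (h : ∀ x, f (x + 1) = f x) (x : ℤ) :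
    f x = f 0 := by
  induction x with
  | zero => rfl
  | succ n ih => rw [h, ih]
  | pred n ih => rw [← ih, ← h, sub_add_cancel]

lemma sum_equiv_of_support {f : ℤ → K} (e : ℤ ≃ ℤ) {S T : Finset ℤ}
    (hS : ∀ k, f (e k) ≠ 0 → k ∈ S) (hT : ∀ k, f k ≠ 0 → k ∈ T) :
    ∑ k ∈ S, f (e k) = ∑ k ∈ T, f k := by
  rw [← finsum_eq_sum_of_support_subset (fun k => f (e k)) (s := S) (by intro k hk; exact hS k hk),
    ← finsum_eq_sum_of_support_subset f (s := T) (by intro k hk; exact hT k hk),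
    finsum_comp_equiv]

/-- The `q`-Vandermonde convolution with arbitrary integer upper entries. -/
lemma sum_pbin_mul_pbin (hp : IsGeneric p) (x y n : ℤ) {S : Finset ℤ}
    (hS : ∀ k, 0 ≤ k → k ≤ n → k ∈ S) :
    ∑ k ∈ S, p ^ ((x - k) * (n - k)) * pbin p x k * pbin p y (n - k) = pbin p (x + y) n := by
  suffices H : ∀ m : ℕ, ∀ n : ℤ, n < m → (∀ k, 0 ≤ k → k ≤ n → k ∈ S) → ∀ y : ℤ,
      ∑ k ∈ S, p ^ ((x - k) * (n - k)) * pbin p x k * pbin p y (n - k) - pbin p (x + y) n = 0 from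
    sub_eq_zero.1 (H (n + 1).toNat n (by omega) hS y)
  intro m
  induction m with
  | zero =>
    intro n hn _ y
    rw [pbin_of_neg _ (by simpa using hn), sub_zero]
    refine Finset.sum_eq_zero fun k _ => ?_
    rcases lt_or_ge k 0 with hk | hk
    · simp [pbin_of_neg _ hk]
    · simp [pbin_of_neg _ (show n - k < 0 by push_cast at hn; omega)]
  | succ m ih =>
    intro n hn hS y
    refine (eq_apply_zero_of_apply_add_one (f := fun y => ∑ k ∈ S,
      p ^ ((x - k) * (n - k)) * pbin p x k * pbin p y (n - k) - pbin p (x + y) n)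
      (fun y => ?_) y).trans ?_
    · have h := ih (n - 1) (by push_cast at hn; omega) (fun k h0 h1 => hS k h0 (by omega)) y
      rw [← add_assoc, pbin_add_one hp (x + y)]
      have h2 : ∑ k ∈ S, p ^ ((x - k) * (n - k)) * pbin p x k * pbin p (y + 1) (n - k) =
          ∑ k ∈ S, p ^ ((x - k) * (n - k)) * pbin p x k * pbin p y (n - k) +
          p ^ (x + y + 1 - n) *
            ∑ k ∈ S, p ^ ((x - k) * (n - 1 - k)) * pbin p x k * pbin p y (n - 1 - k) := by
        rw [Finset.mul_sum, ← Finset.sum_add_distrib]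
        refine Finset.sum_congr rfl fun k _ => ?_
        rw [pbin_add_one hp y, show (x - k) * (n - k) = (x - k) * (n - 1 - k) + (x - k) by ring,
          show x + y + 1 - n = (y + 1 - (n - k)) + (x - k) by ring,
          show n - k - 1 = n - 1 - k by ring]
        simp only [zpow_add₀ hp.1]
        ring
      linear_combination h2 + p ^ (x + y + 1 - n) * h
    · rw [sub_eq_zero, Finset.sum_eq_single n]
      · simp
      · intro k _ hk
        rw [pbin_zero_left (by omega), mul_zero]
      · intro hn'
        have : n < 0 := by
          by_contra hn0
          exact hn' (hS n (by omega) le_rfl)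
        simp [pbin_of_neg _ this]

/-- A `q`-analogue of Bizley's identity, equivalent to the `q`-Pfaff–Saalschütz sum, with arbitrary
integer upper entries. -/
lemma sum_pbin_mul_pbin_mul_pbin (hp : IsGeneric p) (a x s n : ℤ) (e : ℤ ≃ ℤ) {S : Finset ℤ}
    (hS : ∀ k, 0 ≤ e k → e k ≤ n → k ∈ S) :
    ∑ k ∈ S, p ^ ((a - e k) * (n - e k)) * pbin p a (e k) * pbin p (s - a) (n - e k) *
      pbin p (x + e k) s = pbin p x (s - n) * pbin p (x + n - s + a) n := by
  have supp (s x n k : ℤ) (h : p ^ ((a - k) * (n - k)) * pbin p a k * pbin p (s - a) (n - k) *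
      pbin p (x + k) s ≠ 0) : 0 ≤ k ∧ k ≤ n := by
    constructor
    · by_contra hk
      exact h (by simp [pbin_of_neg _ (not_le.1 hk)])
    · by_contra hk
      exact h (by simp [pbin_of_neg _ (show n - k < 0 by omega)])
  rw [sum_equiv_of_support e (T := Finset.Icc 0 n) (f := fun k => p ^ ((a - k) * (n - k)) *
    pbin p a k * pbin p (s - a) (n - k) * pbin p (x + k) s)
    (fun k hk => hS k (supp _ _ _ _ hk).1 (supp _ _ _ _ hk).2)
    (fun k hk => Finset.mem_Icc.2 (supp _ _ _ _ hk))]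
  generalize hT : Finset.Icc 0 n = T
  replace hT : ∀ k, 0 ≤ k → k ≤ n → k ∈ T := fun k h0 h1 => hT ▸ Finset.mem_Icc.2 ⟨h0, h1⟩
  clear hS
  rcases lt_or_ge s 0 with hs | hs
  · rw [Finset.sum_eq_zero fun k _ => by rw [pbin_of_neg _ hs, mul_zero]]
    rcases lt_or_ge n 0 with hn | hn
    · rw [pbin_of_neg _ hn, mul_zero]
    · rw [pbin_of_neg _ (show s - n < 0 by omega), zero_mul]
  lift s to ℕ using hs
  induction s generalizing x n with
  | zero =>
    have h := sum_pbin_mul_pbin hp a (-a) n hT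
    simp only [Nat.cast_zero, zero_sub, pbin_zero_right, mul_one]
    rw [h, add_neg_cancel]
    rcases lt_trichotomy n 0 with hn | rfl | hn
    · simp [pbin_of_neg _ hn]
    · simp
    · rw [pbin_zero_left hn.ne', pbin_of_neg x (show -n < 0 by omega), zero_mul]
  | succ s ih =>
    push_cast
    refine sub_eq_zero.1 ((eq_apply_zero_of_apply_add_one (f := fun x : ℤ => ∑ k ∈ T,
      p ^ ((a - k) * (n - k)) * pbin p a k * pbin p ((s : ℤ) + 1 - a) (n - k) *
      pbin p (x + k) ((s : ℤ) + 1) - pbin p x ((s : ℤ) + 1 - n) *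
      pbin p (x + n - ((s : ℤ) + 1) + a) n) (fun x => ?_) x).trans ?_)
    · have h1 := ih x n hT
      have h2 := ih x (n - 1) fun k h0 hk => hT k h0 (by omega)
      have h3 : ∑ k ∈ T, p ^ ((a - k) * (n - k)) * pbin p a k *
            pbin p ((s : ℤ) + 1 - a) (n - k) * pbin p (x + 1 + k) ((s : ℤ) + 1) =
          ∑ k ∈ T, p ^ ((a - k) * (n - k)) * pbin p a k *
            pbin p ((s : ℤ) + 1 - a) (n - k) * pbin p (x + k) ((s : ℤ) + 1) +
          p ^ (x - s + n) * ∑ k ∈ T, p ^ ((a - k) * (n - k)) * pbin p a k *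
            pbin p ((s : ℤ) - a) (n - k) * pbin p (x + k) s +
          p ^ (x - s + a) * ∑ k ∈ T, p ^ ((a - k) * (n - 1 - k)) * pbin p a k *
            pbin p ((s : ℤ) - a) (n - 1 - k) * pbin p (x + k) s := by
        rw [Finset.mul_sum, Finset.mul_sum, ← Finset.sum_add_distrib, ← Finset.sum_add_distrib]
        refine Finset.sum_congr rfl fun k _ => ?_
        have e1 := pbin_add_one hp (x + k) ((s : ℤ) + 1)
        have e2 := pbin_add_one' hp ((s : ℤ) - a) (n - k)
        rw [show x + k + 1 = x + 1 + k by ring, add_sub_cancel_right,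
          show x + 1 + k - ((s : ℤ) + 1) = (x - s) + k by ring] at e1
        rw [show (s : ℤ) - a + 1 = (s : ℤ) + 1 - a by ring,
          show n - k - 1 = n - 1 - k by ring] at e2
        rw [e1, mul_add, add_assoc]
        congr 1
        rw [e2, show (a - k) * (n - k) = (a - k) * (n - 1 - k) + (a - k) by ring,
          show x - s + n = (x - s) + k + (n - k) by ring,
          show x - (s : ℤ) + a = (x - s) + k + (a - k) by ring]
        simp only [zpow_add₀ hp.1]
        ring
      have e1 := pbin_add_one hp x ((s : ℤ) + 1 - n)
      have e2 := pbin_add_one hp (x + n - ((s : ℤ) + 1) + a) n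
      rw [show x + 1 - ((s : ℤ) + 1 - n) = x - s + n by ring,
        show (s : ℤ) + 1 - n - 1 = s - n by ring] at e1
      rw [show x + n - ((s : ℤ) + 1) + a + 1 = x + n - s + a by ring,
        show x + n - s + a - n = x - s + a by ring] at e2
      rw [show (s : ℤ) - (n - 1) = s + 1 - n by ring,
        show x + (n - 1) - s + a = x + n - (s + 1) + a by ring] at h2
      rw [h3, h1, h2, e1, show x + 1 + n - ((s : ℤ) + 1) + a = x + n - s + a by ring, e2]
      ring
    · have h0 : (s : ℤ) + 1 = (s + 1 : ℕ) := by push_cast; rfl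
      rw [h0]
      generalize s + 1 = s
      rw [sub_eq_zero]
      have h := sum_pbin_mul_pbin hp (a - s) (s - a) (n - s) (S := Finset.Icc 0 (n - s))
        fun k h0 h1 => Finset.mem_Icc.2 ⟨h0, h1⟩
      have h2 := sum_equiv_of_support (Equiv.subRight (s : ℤ)) (S := T)
        (T := Finset.Icc 0 (n - s)) (f := fun k => p ^ ((a - s - k) * (n - s - k)) *
          pbin p (a - s) k * pbin p (s - a) (n - s - k)) ?_ ?_
      · rw [h] at h2
        have h3 : ∑ k ∈ T, p ^ ((a - k) * (n - k)) * pbin p a k *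
            pbin p ((s : ℤ) - a) (n - k) * pbin p (0 + k) (s : ℤ) =
            pbin p a s * pbin p (a - s + (s - a)) (n - s) := by
          rw [← h2, Finset.mul_sum]
          refine Finset.sum_congr rfl fun k _ => ?_
          simp only [Equiv.subRight_apply]
          rw [show a - s - (k - s) = a - k by ring, show n - s - (k - s) = n - k by ring]
          linear_combination (p ^ ((a - k) * (n - k)) * pbin p ((s : ℤ) - a) (n - k)) *
            (by simpa using pbin_mul_pbin hp a k s :
              pbin p a k * pbin p (0 + k) s = pbin p a s * pbin p (a - s) (k - s))
        rw [h3, show a - (s : ℤ) + (s - a) = 0 by ring]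
        rcases eq_or_ne n s with rfl | hn
        · simp
        · rw [pbin_zero_left (k := n - s) (by omega), pbin_zero_left (k := (s : ℤ) - n) (by omega),
            mul_zero, zero_mul]
      · intro k hk
        simp only [Equiv.subRight_apply] at hk
        refine hT k ?_ ?_
        · by_contra hk0
          exact hk (by simp [pbin_of_neg _ (show k - (s : ℤ) < 0 by omega)])
        · by_contra hk0
          exact hk (by rw [pbin_of_neg _ (show n - s - (k - (s : ℤ)) < 0 by omega), mul_zero])
      · intro k hk
        rw [Finset.mem_Icc]
        constructor
        · by_contra hk0
          exact hk (by simp [pbin_of_neg _ (show k < 0 by omega)])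
        · by_contra hk0
          exact hk (by simp [pbin_of_neg _ (show n - s - k < 0 by omega)])

/-- The summand of the double sum after the shift `n = i + k`. -/
def innerTerm (p : K) (L M a b n k : ℤ) : K :=
  p ^ (M * (n - k) + k ^ 2) * gb p (L - M) (n - k) * gb p (L + M - 2 * n) (L - n + k) *
    gb p (L - n + k - (a - b)) (k - a) * gb p (L - n + k + (a - b)) (k + a)

/-- The double summand interpolating between the two sides of the transformation. -/
def interTerm (p : K) (L M a b n t : ℤ) : K :=
  p ^ (t ^ 2 + b * (t - n) + n * (n - t)) * gb p (M - (a - b)) (t + b) *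
    (qfac p (M + (a - b)) * qfac p (L - a - t) * qfacInv p M * qfacInv p (L - b - t)) *
    gb p M (n - a) * gb p (a - b) (t - n) * gb p (L + M + (a - b) - t - n) (M + (a - b))

/-- The summand of `p^(a^2) S(L,M,a+b,2a)` after a shift of the index by `a`. -/
def outerTerm (p : K) (L M a b t : ℤ) : K :=
  p ^ (a ^ 2 + (t - a) * (t + b)) * gb p (L + M + (a - b) - 2 * t) M *
    gb p (M + (a - b)) (t - a) * gb p (M - (a - b)) (t + b)

lemma sum_interTerm (hp : IsGeneric p) {L M a b : ℤ} (hd : 0 ≤ a - b) (hdM : a - b ≤ M)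
    (hML : M ≤ L) (t : ℤ) {S : Finset ℤ} (hS : ∀ n, a ≤ n → n ≤ t → n ∈ S) :
    ∑ n ∈ S, interTerm p L M a b n t = outerTerm p L M a b t := by
  rcases lt_or_ge (t + b) 0 with h1 | h1
  · simp [interTerm, outerTerm, gb_of_neg _ h1]
  rcases lt_or_ge (M - a) t with h2 | h2
  · simp [interTerm, outerTerm, gb_of_lt (show M - (a - b) < t + b by omega)]
  have key := sum_pbin_mul_pbin_mul_pbin hp (a - b) (L + M + (a - b) - 2 * t) (M + (a - b)) (t - a)
    (Equiv.subLeft t) (S := S) (by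
      intro k h0 h1
      simp only [Equiv.subLeft_apply] at h0 h1
      exact hS k (by omega) (by omega))
  simp only [Equiv.subLeft_apply] at key
  have hsum : ∑ n ∈ S, interTerm p L M a b n t =
      p ^ (a ^ 2 + (t - a) * (t + b)) * gb p (M - (a - b)) (t + b) *
        (qfac p (M + (a - b)) * qfac p (L - a - t) * qfacInv p M * qfacInv p (L - b - t)) *
        (pbin p (L + M + (a - b) - 2 * t) (M + (a - b) - (t - a)) *
          pbin p (L + M + (a - b) - 2 * t + (t - a) - (M + (a - b)) + (a - b)) (t - a)) := by
    rw [← key, Finset.mul_sum]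
    refine Finset.sum_congr rfl fun n _ => ?_
    rw [interTerm, gb_eq_pbin (n := M) _ (by omega), gb_eq_pbin (n := a - b) _ hd]
    rw [show M + (a - b) - (a - b) = M by ring, show t - a - (t - n) = n - a by ring,
      show L + M + (a - b) - 2 * t + (t - n) = L + M + (a - b) - t - n by ring]
    rcases lt_or_ge (M + a) n with h3 | h3
    · simp [pbin_of_lt (show 0 ≤ M by omega) (show M < n - a by omega)]
    rw [gb_eq_pbin (n := L + M + (a - b) - t - n) _ (by omega),
      show t ^ 2 + b * (t - n) + n * (n - t) =
        (a ^ 2 + (t - a) * (t + b)) + (a - b - (t - n)) * (n - a) by ring, zpow_add₀ hp.1]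
    ring
  rw [hsum, outerTerm]
  rw [show L + M + (a - b) - 2 * t + (t - a) - (M + (a - b)) + (a - b) = L - b - t by ring]
  rcases lt_or_ge t a with h3 | h3
  · simp [pbin_of_neg _ (show t - a < 0 by omega), gb_of_neg _ (show t - a < 0 by omega)]
  rcases lt_or_ge (M + (a - b)) (t - a) with h4 | h4
  · simp [pbin_of_neg _ (show M + (a - b) - (t - a) < 0 by omega), gb_of_lt h4]
  rcases lt_or_ge (L + (a - b) - 2 * t) 0 with h5 | h5
  · simp [pbin_of_lt (show 0 ≤ L - b - t by omega) (show L - b - t < t - a by omega),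
      gb_of_lt (show L + M + (a - b) - 2 * t < M by omega)]
  rw [pbin_eq_qfac hp _ (show 0 ≤ L + M + (a - b) - 2 * t by omega),
    pbin_eq_qfac hp _ (show 0 ≤ L - b - t by omega),
    gb_eq_qfac hp _ (show 0 ≤ L + M + (a - b) - 2 * t by omega),
    gb_eq_qfac hp (t - a) (show 0 ≤ M + (a - b) by omega),
    show L + M + (a - b) - 2 * t - (M + (a - b) - (t - a)) = L - a - t by ring,
    show L - b - t - (t - a) = L + M + (a - b) - 2 * t - M by ring]
  have f1 := qfac_mul_qfacInv hp (show 0 ≤ L - a - t by omega)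
  have f2 := qfac_mul_qfacInv hp (show 0 ≤ L - b - t by omega)
  generalize qfac p (L - a - t) = x1 at *
  generalize qfacInv p (L - a - t) = y1 at *
  generalize qfac p (L - b - t) = x2 at *
  generalize qfacInv p (L - b - t) = y2 at *
  trans (p ^ (a ^ 2 + (t - a) * (t + b)) * (qfac p (L + M + (a - b) - 2 * t) * qfacInv p M *
    qfacInv p (L + M + (a - b) - 2 * t - M)) * (qfac p (M + (a - b)) * qfacInv p (t - a) *
      qfacInv p (M + (a - b) - (t - a))) * gb p (M - (a - b)) (t + b)) * ((x1 * y1) * (x2 * y2))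
  · ring
  · rw [f1, f2]; ring

lemma innerTerm_support {L M a b n k : ℤ} (h : innerTerm p L M a b n k ≠ 0) :
    (0 ≤ n - k ∧ n - k ≤ L - M) ∧ (0 ≤ k - a ∧ 0 ≤ k + a) ∧ n + k ≤ M ∧
      0 ≤ L - n + b ∧ 0 ≤ L - n - b := by
  simp only [innerTerm, mul_ne_zero_iff] at h
  obtain ⟨⟨⟨⟨-, h1⟩, h2⟩, h3⟩, h4⟩ := h
  have := gb_support h1
  have := gb_support h2
  have := gb_support h3
  have := gb_support h4
  omega

lemma interTerm_support {L M a b n t : ℤ} (h : interTerm p L M a b n t ≠ 0) :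
    (0 ≤ t + b ∧ t ≤ M - a) ∧ (0 ≤ n - a ∧ n - a ≤ M) ∧ (0 ≤ t - n ∧ t - n ≤ a - b) ∧
      t + n ≤ L := by
  simp only [interTerm, mul_ne_zero_iff] at h
  obtain ⟨⟨⟨⟨⟨-, h1⟩, -⟩, h2⟩, h3⟩, h4⟩ := h
  have := gb_support h1
  have := gb_support h2
  have := gb_support h3
  have := gb_support h4
  omega

lemma outerTerm_support {L M a b t : ℤ} (h : outerTerm p L M a b t ≠ 0) :
    (0 ≤ M ∧ 2 * t ≤ L + (a - b)) ∧ (0 ≤ t - a ∧ t - a ≤ M + (a - b)) ∧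
      0 ≤ t + b ∧ t + b ≤ M - (a - b) := by
  simp only [outerTerm, mul_ne_zero_iff] at h
  obtain ⟨⟨⟨-, h1⟩, h2⟩, h3⟩ := h
  have := gb_support h1
  have := gb_support h2
  have := gb_support h3
  omega

/-- The factor of the summand that does not depend on the inner summation index. -/
def outerFactor (p : K) (L M a b n : ℤ) : K :=
  qfac p (L - M) * qfac p (L + M - 2 * n) * qfac p (a - b) * qfac p (M - (a - b)) *
    qfacInv p (L - n + b) * qfacInv p (L - n - b) * qfacInv p (M - n + a) * qfacInv p (n - a)

lemma innerTerm_eq (hp : IsGeneric p) {L M a b n : ℤ} (hd : 0 ≤ a - b) (hdM : a - b ≤ M)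
    (hML : M ≤ L) (h1 : a ≤ n) (h3 : n ≤ M - a) (h4 : n ≤ M + a)
    (h5 : 0 ≤ L - n - b) (h6 : 0 ≤ L - n + b) (k : ℤ) :
    innerTerm p L M a b n k = outerFactor p L M a b n * (p ^ (M * (n - k) + k ^ 2) *
      (pbin p (L - n + k + (a - b)) (L - n + k) * pbin p (M - n + a) (M - n - k)) *
      pbin p (L - n + k - (a - b)) (M - (a - b)) * pbin p (n - a) (k - a)) := by
  rcases lt_or_ge k a with h7 | h7
  · simp [innerTerm, gb_of_neg _ (show k - a < 0 by omega),
      pbin_of_neg _ (show k - a < 0 by omega)]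
  rcases lt_or_ge k (-a) with h8 | h8
  · simp [innerTerm, gb_of_neg _ (show k + a < 0 by omega),
      pbin_of_lt (show 0 ≤ M - n + a by omega) (show M - n + a < M - n - k by omega)]
  rcases lt_or_ge (M - n) k with h9 | h9
  · simp [innerTerm, gb_of_lt (show L + M - 2 * n < L - n + k by omega),
      pbin_of_neg _ (show M - n - k < 0 by omega)]
  rw [innerTerm, gb_eq_qfac hp _ (show 0 ≤ L - M by omega),
    gb_eq_qfac hp _ (show 0 ≤ L + M - 2 * n by omega),
    gb_eq_qfac hp _ (show 0 ≤ L - n + k - (a - b) by omega),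
    gb_eq_qfac hp _ (show 0 ≤ L - n + k + (a - b) by omega),
    pbin_eq_qfac hp _ (show 0 ≤ L - n + k + (a - b) by omega),
    pbin_eq_qfac hp _ (show 0 ≤ M - n + a by omega),
    pbin_eq_qfac hp _ (show 0 ≤ L - n + k - (a - b) by omega),
    pbin_eq_qfac hp _ (show 0 ≤ n - a by omega),
    show L + M - 2 * n - (L - n + k) = M - n - k by ring,
    show L - n + k - (a - b) - (k - a) = L - n + b by ring,
    show L - n + k + (a - b) - (k + a) = L - n - b by ring,
    show L - n + k + (a - b) - (L - n + k) = a - b by ring,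
    show M - n + a - (M - n - k) = k + a by ring,
    show L - n + k - (a - b) - (M - (a - b)) = L - M - (n - k) by ring,
    show n - a - (k - a) = n - k by ring, outerFactor]
  have h : (qfac p (a - b) * qfacInv p (a - b)) *
      (qfac p (M - (a - b)) * qfacInv p (M - (a - b))) *
      (qfac p (M - n + a) * qfacInv p (M - n + a)) *
      (qfac p (n - a) * qfacInv p (n - a)) = 1 := by
    rw [qfac_mul_qfacInv hp hd, qfac_mul_qfacInv hp (by omega), qfac_mul_qfacInv hp (by omega),
      qfac_mul_qfacInv hp (by omega)]
    norm_num
  linear_combination (-(p ^ (M * (n - k) + k ^ 2) * (qfac p (L - M) *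
    qfacInv p (n - k) * qfacInv p (L - M - (n - k))) * (qfac p (L + M - 2 * n) *
    qfacInv p (L - n + k) * qfacInv p (M - n - k)) * (qfac p (L - n + k - (a - b)) *
    qfacInv p (k - a) * qfacInv p (L - n + b)) * (qfac p (L - n + k + (a - b)) *
    qfacInv p (k + a) * qfacInv p (L - n - b)))) * h

lemma interTerm_eq (hp : IsGeneric p) {L M a b n : ℤ} (hd : 0 ≤ a - b) (hdM : a - b ≤ M)
    (hML : M ≤ L) (h3 : n ≤ M - a) (h4 : n ≤ M + a)
    (h5 : 0 ≤ L - n - b) (h6 : 0 ≤ L - n + b) (t : ℤ) :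
    interTerm p L M a b n t = outerFactor p L M a b n *
      (p ^ (t ^ 2 + b * (t - n) + n * (n - t)) * pbin p (L - n - b) (t - n) *
        pbin p (L + M + (a - b) - t - n) (L + M - 2 * n) *
        (pbin p (L - n + b) (t + b) * pbin p (L - a - t) (M - a - t))) := by
  rcases lt_or_ge (t + b) 0 with h7 | h7
  · simp [interTerm, gb_of_neg _ h7, pbin_of_neg _ h7]
  rcases lt_or_ge (M - a) t with h8 | h8
  · simp [interTerm, gb_of_lt (show M - (a - b) < t + b by omega),
      pbin_of_neg _ (show M - a - t < 0 by omega)]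
  rcases lt_or_ge t n with h9 | h9
  · simp [interTerm, gb_of_neg _ (show t - n < 0 by omega),
      pbin_of_neg _ (show t - n < 0 by omega)]
  rw [interTerm, gb_eq_qfac hp _ (show 0 ≤ M - (a - b) by omega),
    gb_eq_qfac hp _ (show 0 ≤ M by omega), gb_eq_qfac hp _ hd,
    gb_eq_qfac hp _ (show 0 ≤ L + M + (a - b) - t - n by omega),
    pbin_eq_qfac hp _ h5, pbin_eq_qfac hp _ h6,
    pbin_eq_qfac hp _ (show 0 ≤ L + M + (a - b) - t - n by omega),
    pbin_eq_qfac hp _ (show 0 ≤ L - a - t by omega),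
    show M - (a - b) - (t + b) = M - a - t by ring,
    show M - (n - a) = M - n + a by ring,
    show L + M + (a - b) - t - n - (M + (a - b)) = L - n - t by ring,
    show L - n - b - (t - n) = L - b - t by ring,
    show L + M + (a - b) - t - n - (L + M - 2 * n) = a - b - (t - n) by ring,
    show L - n + b - (t + b) = L - n - t by ring,
    show L - a - t - (M - a - t) = L - M by ring, outerFactor]
  trans (p ^ (t ^ 2 + b * (t - n) + n * (n - t)) * qfac p (M - (a - b)) * qfac p (a - b) *
    qfac p (L + M + (a - b) - t - n) * qfac p (L - a - t) * qfacInv p (t + b) *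
    qfacInv p (M - a - t) * qfacInv p (L - b - t) * qfacInv p (n - a) * qfacInv p (M - n + a) *
    qfacInv p (t - n) * qfacInv p (a - b - (t - n)) * qfacInv p (L - n - t))
  · have h : (qfac p M * qfacInv p M) * (qfac p (M + (a - b)) * qfacInv p (M + (a - b))) = 1 := by
      rw [qfac_mul_qfacInv hp (by omega), qfac_mul_qfacInv hp (by omega), one_mul]
    linear_combination (p ^ (t ^ 2 + b * (t - n) + n * (n - t)) * qfac p (M - (a - b)) *
      qfac p (a - b) *
      qfac p (L + M + (a - b) - t - n) * qfac p (L - a - t) * qfacInv p (t + b) *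
      qfacInv p (M - a - t) * qfacInv p (L - b - t) * qfacInv p (n - a) * qfacInv p (M - n + a) *
      qfacInv p (t - n) * qfacInv p (a - b - (t - n)) * qfacInv p (L - n - t)) * h
  · have h : (qfac p (L - M) * qfacInv p (L - M)) *
        (qfac p (L + M - 2 * n) * qfacInv p (L + M - 2 * n)) *
        (qfac p (L - n + b) * qfacInv p (L - n + b)) *
        (qfac p (L - n - b) * qfacInv p (L - n - b)) = 1 := by
      rw [qfac_mul_qfacInv hp (by omega), qfac_mul_qfacInv hp (by omega),
        qfac_mul_qfacInv hp h6, qfac_mul_qfacInv hp h5]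
      norm_num
    linear_combination (-(p ^ (t ^ 2 + b * (t - n) + n * (n - t)) *
      qfac p (M - (a - b)) * qfac p (a - b) *
      qfac p (L + M + (a - b) - t - n) * qfac p (L - a - t) * qfacInv p (t + b) *
      qfacInv p (M - a - t) * qfacInv p (L - b - t) * qfacInv p (n - a) * qfacInv p (M - n + a) *
      qfacInv p (t - n) * qfacInv p (a - b - (t - n)) * qfacInv p (L - n - t))) * h

lemma sum_innerTerm_eq_sum_interTerm (hp : IsGeneric p) {L M a b : ℤ} (hd : 0 ≤ a - b)
    (hdM : a - b ≤ M) (hML : M ≤ L) (n : ℤ) {S : Finset ℤ}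
    (hS : ∀ k, a ≤ k → k ≤ M - a → k ∈ S) :
    ∑ k ∈ S, innerTerm p L M a b n k = ∑ t ∈ S, interTerm p L M a b n t := by
  by_cases h : a ≤ n ∧ n ≤ M - a ∧ n ≤ M + a ∧ 0 ≤ L - n - b ∧ 0 ≤ L - n + b
  swap
  · rw [Finset.sum_eq_zero fun k _ => by_contra fun hk => ?_,
      Finset.sum_eq_zero fun t _ => by_contra fun ht => ?_]
    · have := interTerm_support ht
      omega
    · have := innerTerm_support hk
      omega
  obtain ⟨h1, h3, h4, h5, h6⟩ := h
  simp only [innerTerm_eq hp hd hdM hML h1 h3 h4 h5 h6,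
    interTerm_eq hp hd hdM hML h3 h4 h5 h6, ← Finset.mul_sum]
  congr 1
  trans ∑ k ∈ S, ∑ t ∈ S, p ^ (t ^ 2 + b * (t - n) + n * (n - t)) *
      pbin p (L - n - b) (t - n) * pbin p (L + M + (a - b) - t - n) (L + M - 2 * n) *
      (p ^ ((n - k) * (M - t - k)) * pbin p (n - a) (k - a) * pbin p (M - n + b) (M - t - k) *
        pbin p (L - n + k - (a - b)) (M - (a - b)))
  · refine Finset.sum_congr rfl fun k _ => ?_
    rcases lt_or_ge k a with h7 | h7
    · simp [pbin_of_neg _ (show k - a < 0 by omega)]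
    have key := sum_pbin_mul_pbin_mul_pbin hp (M - n + b) (L - n + k + (a - b)) (L + M - 2 * n)
      (M - n - k) (Equiv.subLeft (M - k)) (S := S) (by
        intro t h0 h1
        simp only [Equiv.subLeft_apply] at h0 h1
        exact hS t (by omega) (by omega))
    simp only [Equiv.subLeft_apply] at key
    rw [show L + M - 2 * n - (M - n - k) = L - n + k by ring,
      show L - n + k + (a - b) + (M - n - k) - (L + M - 2 * n) + (M - n + b) = M - n + a by ring]
      at key
    rw [← key, Finset.mul_sum, Finset.sum_mul, Finset.sum_mul]
    refine Finset.sum_congr rfl fun t _ => ?_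
    rw [show L + M - 2 * n - (M - n + b) = L - n - b by ring,
      show M - n - k - (M - k - t) = t - n by ring,
      show L - n + k + (a - b) + (M - k - t) = L + M + (a - b) - t - n by ring,
      show M - k - t = M - t - k by ring]
    have he : p ^ (M * (n - k) + k ^ 2) * p ^ ((M - n + b - (M - t - k)) * (t - n)) =
        p ^ (t ^ 2 + b * (t - n) + n * (n - t)) * p ^ ((n - k) * (M - t - k)) := by
      rw [← zpow_add₀ hp.1, ← zpow_add₀ hp.1]
      congr 1
      ring
    linear_combination (pbin p (L - n - b) (t - n) *
      pbin p (L + M + (a - b) - t - n) (L + M - 2 * n) * (pbin p (n - a) (k - a) *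
      pbin p (M - n + b) (M - t - k) * pbin p (L - n + k - (a - b)) (M - (a - b)))) * he
  · rw [Finset.sum_comm]
    refine Finset.sum_congr rfl fun t _ => ?_
    rcases lt_or_ge t n with h7 | h7
    · simp [pbin_of_neg _ (show t - n < 0 by omega)]
    rw [← Finset.mul_sum]
    congr 1
    have key := sum_pbin_mul_pbin_mul_pbin hp (n - a) (L - n + b) (M - (a - b))
      (M - t - a) (Equiv.subRight a) (S := S) (by
        intro k h0 h1
        simp only [Equiv.subRight_apply] at h0 h1
        exact hS k (by omega) (by omega))
    simp only [Equiv.subRight_apply] at key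
    rw [show M - (a - b) - (M - t - a) = t + b by ring,
      show L - n + b + (M - t - a) - (M - (a - b)) + (n - a) = L - a - t by ring,
      show M - t - a = M - a - t by ring] at key
    rw [← key]
    refine Finset.sum_congr rfl fun k _ => ?_
    rw [show n - a - (k - a) = n - k by ring, show M - a - t - (k - a) = M - t - k by ring,
      show M - (a - b) - (n - a) = M - n + b by ring,
      show L - n + b + (k - a) = L - n + k - (a - b) by ring]

lemma sum_innerTerm_of_nonneg (hp : IsGeneric p) {L M a b : ℤ} (ha : -M ≤ 2 * a)
    (hd : 0 ≤ a - b) (hdM : a - b ≤ M) (hML : M ≤ L) :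
    ∑ n ∈ Finset.Icc (-M) (2 * M), ∑ k ∈ Finset.Icc (-M) (2 * M), innerTerm p L M a b n k =
      ∑ t ∈ Finset.Icc (-M) (2 * M), outerTerm p L M a b t := by
  rw [Finset.sum_congr rfl fun n _ => sum_innerTerm_eq_sum_interTerm hp hd hdM hML n
    fun k h1 h2 => Finset.mem_Icc.2 (by omega), Finset.sum_comm]
  refine Finset.sum_congr rfl fun t ht => sum_interTerm hp hd hdM hML t fun n h1 h2 => ?_
  rw [Finset.mem_Icc] at ht ⊢
  omega

lemma innerTerm_neg (L M a b n k : ℤ) :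
    innerTerm p L M (-a) (-b) n k = innerTerm p L M a b n k := by
  rw [innerTerm, innerTerm, show L - n + k - (-a - -b) = L - n + k + (a - b) by ring,
    show L - n + k + (-a - -b) = L - n + k - (a - b) by ring, sub_neg_eq_add, ← sub_eq_add_neg]
  ring

lemma outerTerm_neg (L M a b t : ℤ) :
    outerTerm p L M (-a) (-b) t = outerTerm p L M a b (t + (a - b)) := by
  rw [outerTerm, outerTerm, show (-a) ^ 2 + (t - -a) * (t + -b) =
      a ^ 2 + (t + (a - b) - a) * (t + (a - b) + b) by ring,
    show L + M + (-a - -b) - 2 * t = L + M + (a - b) - 2 * (t + (a - b)) by ring,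
    show M + (-a - -b) = M - (a - b) by ring, show M - (-a - -b) = M + (a - b) by ring,
    show t - -a = t + (a - b) + b by ring, show t + -b = t + (a - b) - a by ring]
  ring

lemma sum_innerTerm_eq_sum_outerTerm (hp : IsGeneric p) {L M a b : ℤ} (ha : -M ≤ 2 * a)
    (ha' : 2 * a ≤ M) (hd : -M ≤ a - b) (hd' : a - b ≤ M) (hML : M ≤ L) :
    ∑ n ∈ Finset.Icc (-M) (2 * M), ∑ k ∈ Finset.Icc (-M) (2 * M), innerTerm p L M a b n k =
      ∑ t ∈ Finset.Icc (-M) (2 * M), outerTerm p L M a b t := by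
  rcases le_total 0 (a - b) with h | h
  · exact sum_innerTerm_of_nonneg hp ha h hd' hML
  have h1 := sum_innerTerm_of_nonneg hp (a := -a) (b := -b) (by omega) (by omega) (by omega) hML
  simp only [innerTerm_neg, outerTerm_neg] at h1
  rw [h1]
  refine sum_equiv_of_support (f := outerTerm p L M a b) (Equiv.addRight (a - b))
    (fun t ht => ?_) (fun t ht => ?_)
  · have := outerTerm_support ht
    simp only [Equiv.coe_addRight] at this
    exact Finset.mem_Icc.2 (by omega)
  · have := outerTerm_support ht
    exact Finset.mem_Icc.2 (by omega)

lemma sum_range_natCast_of_support {f : ℤ → K} (e : ℤ ≃ ℤ) {m : ℤ} {T : Finset ℤ}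
    (hS : ∀ k, f (e k) ≠ 0 → 0 ≤ k ∧ k ≤ m) (hT : ∀ k, f k ≠ 0 → k ∈ T) :
    ∑ k ∈ Finset.range (m.toNat + 1), f (e k) = ∑ k ∈ T, f k := by
  rw [← sum_equiv_of_support e (S := (Finset.range (m.toNat + 1)).map Nat.castEmbedding) _ hT,
    Finset.sum_map]
  · rfl
  · intro k hk
    have := hS k hk
    exact Finset.mem_map.2 ⟨k.toNat, Finset.mem_range.2 (by omega), by simp; omega⟩

lemma Bq_eq_gb_mul_gb (hp : IsGeneric p) (L a b : ℤ) (i k : ℕ) :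
    Bq p (k : ℚ) ((L : ℚ) - i - k) (a : ℚ) (b : ℚ) =
      gb p (L - (i + k) + k - (a - b)) (k - a) * gb p (L - (i + k) + k + (a - b)) (k + a) := by
  have h1 : (L : ℚ) - i - k + b + k - a = ((L - (i + k) + k - (a - b) : ℤ) : ℚ) := by
    push_cast; ring
  have h2 : (L : ℚ) - i - k + b = ((L - i - k + b : ℤ) : ℚ) := by push_cast; ring
  have h3 : (L : ℚ) - i - k - b + k + a = ((L - (i + k) + k + (a - b) : ℤ) : ℚ) := by
    push_cast; ring
  have h4 : (L : ℚ) - i - k - b = ((L - i - k - b : ℤ) : ℚ) := by push_cast; ring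
  rw [Bq, h1, h2, h3, h4]
  simp only [Int.floor_intCast]
  rw [gb_symm hp _ (k - a), gb_symm hp _ (k + a)]
  congr 2 <;> ring

lemma summand_eq_innerTerm (hp : IsGeneric p) (L M a b : ℤ) (i k : ℕ) :
    p ^ (M * (i : ℤ) + (k : ℤ) ^ 2) * gb p (L - M) i * gb p (L + M - 2 * i - 2 * k) (L - i) *
        Bq p (k : ℚ) ((L : ℚ) - i - k) (a : ℚ) (b : ℚ) =
      innerTerm p L M a b (i + k) k := by
  rw [Bq_eq_gb_mul_gb hp, innerTerm, add_sub_cancel_right,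
    show L + M - 2 * ((i : ℤ) + k) = L + M - 2 * i - 2 * k by ring,
    show L - ((i : ℤ) + k) + k = L - i by ring]
  ring

lemma zpow_mul_Sr (hp : IsGeneric p) (L M a b : ℤ) :
    p ^ (a ^ 2) * Sr p L M (a + b) (2 * a) =
      ∑ s ∈ Finset.range (L.toNat + 1), outerTerm p L M a b (s + a) := by
  rw [Sr, Finset.mul_sum]
  refine Finset.sum_congr rfl fun s _ => ?_
  rw [outerTerm, zpow_add₀ hp.1, add_sub_cancel_right,
    show L + M + (a - b) - 2 * ((s : ℤ) + a) = L + M - (a + b) - 2 * s by ring,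
    show M + (a - b) = M - (a + b) + 2 * a by ring,
    show M - (a - b) = M + (a + b) - 2 * a by ring, add_assoc (s : ℤ)]
  ring

lemma sum_range_innerTerm (p : K) (L M a b : ℤ) :
    ∑ i ∈ Finset.range ((L - M).toNat + 1), ∑ k ∈ Finset.range (L.toNat + 1),
        innerTerm p L M a b (i + k) k =
      ∑ n ∈ Finset.Icc (-M) (2 * M), ∑ k ∈ Finset.Icc (-M) (2 * M), innerTerm p L M a b n k := by
  rw [Finset.sum_comm, Finset.sum_comm (s := Finset.Icc (-M) (2 * M))]
  rw [← sum_range_natCast_of_support (Equiv.refl ℤ) (m := L)]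
  · refine Finset.sum_congr rfl fun k _ => ?_
    refine sum_range_natCast_of_support (f := fun n => innerTerm p L M a b n k)
      (Equiv.addRight (k : ℤ)) (fun i hi => ?_) (fun n hn => ?_)
    · have := innerTerm_support hi
      simp only [Equiv.coe_addRight] at this
      omega
    · have := innerTerm_support hn
      exact Finset.mem_Icc.2 (by omega)
  all_goals
    intro k hk
    obtain ⟨n, -, hn⟩ := Finset.exists_ne_zero_of_sum_ne_zero hk
    have := innerTerm_support hn
    simp only [Equiv.refl_apply, Finset.mem_Icc] at this ⊢
    omega

lemma sum_range_outerTerm (p : K) {L a b : ℤ} (M : ℤ) (h : -(a + b) ≤ L) :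
    ∑ s ∈ Finset.range (L.toNat + 1), outerTerm p L M a b (s + a) =
      ∑ t ∈ Finset.Icc (-M) (2 * M), outerTerm p L M a b t := by
  refine sum_range_natCast_of_support (f := outerTerm p L M a b) (Equiv.addRight a)
    (fun s hs => ?_) (fun t ht => ?_)
  · have := outerTerm_support hs
    simp only [Equiv.coe_addRight] at this
    omega
  · have := outerTerm_support ht
    exact Finset.mem_Icc.2 (by omega)

end

/-- S-to-B double-sum transformation: for integers `L, M, a, b` with `M ≤ L` and
`|a-b| ≤ M` whenever `|a| ≤ M/2`, `|a+b| ≤ L` and `|a-b| ≤ max{L,M}`: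
`Σ_{i=0}^{L-M} Σ_{k=0}^{L} q^{Mi+k²} [L-M choose i][L+M-2i-2k choose L-i] B(k, L-i-k, a, b)
= q^{a²} S(L, M, a+b, 2a)`. -/
theorem S_to_B (L M a b : ℤ)
    (h : 2 * |a| ≤ M → |a + b| ≤ L → |a - b| ≤ max L M → M ≤ L ∧ |a - b| ≤ M) :
    ∑ i ∈ Finset.range ((L - M).toNat + 1), ∑ k ∈ Finset.range (L.toNat + 1),
      tq ^ (M * (i : ℤ) + (k : ℤ) ^ 2) * gb tq (L - M) i *
        gb tq (L + M - 2 * i - 2 * k) (L - i) *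
        Bq tq (k : ℚ) ((L : ℚ) - i - k) (a : ℚ) (b : ℚ) =
      tq ^ (a ^ 2) * Sr tq L M (a + b) (2 * a) := by
  simp only [summand_eq_innerTerm tq_isGeneric, zpow_mul_Sr tq_isGeneric]
  by_cases hc : 2 * |a| ≤ M ∧ |a + b| ≤ L ∧ |a - b| ≤ max L M
  · obtain ⟨hML, hd⟩ := h hc.1 hc.2.1 hc.2.2
    have ha : |a| ≤ M / 2 := by omega
    have hs := hc.2.1
    rw [abs_le] at ha hd hs
    rw [sum_range_innerTerm, sum_range_outerTerm tq M (by omega),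
      sum_innerTerm_eq_sum_outerTerm tq_isGeneric (by omega) (by omega) hd.1 hd.2 hML]
  · have hc' : ¬ ((2 * a ≤ M ∧ -(2 * a) ≤ M) ∧ (a + b ≤ L ∧ -(a + b) ≤ L) ∧
        (a - b ≤ max L M ∧ -(a - b) ≤ max L M)) := by
      contrapose! hc
      simp only [abs_le]
      rcases abs_cases a with h1 | h1 <;> omega
    trans 0
    · refine Finset.sum_eq_zero fun i _ => Finset.sum_eq_zero fun k _ => by_contra fun hk => ?_
      have := innerTerm_support hk
      omega
    · refine (Finset.sum_eq_zero fun s _ => by_contra fun hs => ?_).symm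
      have := outerTerm_support hs
      omega
end
end
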